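/- arXiv:1805.09151 — 3 statements merged into one kernel-verified Lean document; each statement's English description precedes it below -/
import Mathlib

section
/- Let G ∈ 𝒞𝒢^s(n) with 2 ≤ s ≤ n−3, let v* be a vertex of minimum degree t of G, and set X = N(v*), Y = V(G) ∖ N[v*]. Suppose G[Y] is isomorphic to a complete multipartite graph K_{n_1,…,n_l} with l ≥ 2 parts (so G[Y] has no isolated vertices), and let y, y' ∈ Y be two non-adjacent vertices. Then G ∈ 𝒢_1^s(n) if N_X(y) = N_X(y'), and G ∈ 𝒢_2^s(n) otherwise. -/
open Matrix BigOperators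

namespace TwoPosEig

variable {V : Type*}

/-- The real adjacency matrix of a simple graph (classical decidability). -/
noncomputable def adjMat [Fintype V] [DecidableEq V] (G : SimpleGraph V) : Matrix V V ℝ :=
  letI := Classical.decRel G.Adj
  G.adjMatrix ℝ

lemma adjMat_isHermitian [Fintype V] [DecidableEq V] (G : SimpleGraph V) :
    (adjMat G).IsHermitian := by
  letI := Classical.decRel G.Adj
  rw [Matrix.IsHermitian, Matrix.conjTranspose_eq_transpose_of_trivial]
  exact SimpleGraph.isSymm_adjMatrix G

/-- The eigenvalues of (the adjacency matrix of) a graph, as a function on vertices. -/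
noncomputable def eigs [Fintype V] [DecidableEq V] (G : SimpleGraph V) : V → ℝ :=
  (adjMat_isHermitian G).eigenvalues

/-- `p(G)`: the number of positive eigenvalues (with multiplicity). -/
noncomputable def posCount [Finite V] (G : SimpleGraph V) : ℕ :=
  letI := Fintype.ofFinite V
  letI := Classical.decEq V
  Nat.card {i : V // 0 < eigs G i}

/-- `η(G)`: the number of zero eigenvalues (with multiplicity), the nullity. -/
noncomputable def nullCount [Finite V] (G : SimpleGraph V) : ℕ :=
  letI := Fintype.ofFinite V
  letI := Classical.decEq V
  Nat.card {i : V // eigs G i = 0}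

/-- `λ_k(G)`: the `k`-th largest eigenvalue (1-indexed); junk value `0` out of range. -/
noncomputable def lam [Finite V] (G : SimpleGraph V) (k : ℕ) : ℝ :=
  letI := Fintype.ofFinite V
  letI := Classical.decEq V
  (((Finset.univ.val.map (eigs G)).sort (· ≤ ·)).reverse).getD (k - 1) 0

/-- Membership in `𝒢^s(n)` (the order `n` being the cardinality of the vertex type):
`p(G) = 2` and `η(G) = s`. -/
def memClass [Finite V] (s : ℕ) (G : SimpleGraph V) : Prop :=
  posCount G = 2 ∧ nullCount G = s

/-- `v` is a congruent vertex of I-type: some other vertex `u`, non-adjacent to `v`,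
has the same neighbourhood. -/
def ITypeVertex (G : SimpleGraph V) (v : V) : Prop :=
  ∃ u, u ≠ v ∧ ¬ G.Adj u v ∧ G.neighborSet u = G.neighborSet v

/-- `u` is a congruent vertex of II-type: there are two non-adjacent vertices `v, w`
such that `N(u)` is a disjoint union of `N(v)` and `N(w)`. -/
def IITypeVertex (G : SimpleGraph V) (u : V) : Prop :=
  ∃ v w, v ≠ w ∧ ¬ G.Adj v w ∧ Disjoint (G.neighborSet v) (G.neighborSet w) ∧
    G.neighborSet u = G.neighborSet v ∪ G.neighborSet w

/-- `u v x y` is a congruent (induced) quadrangle with congruent edges `uv`, `xy`. -/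
def CongruentQuad (G : SimpleGraph V) (u v x y : V) : Prop :=
  u ≠ v ∧ u ≠ x ∧ u ≠ y ∧ v ≠ x ∧ v ≠ y ∧ x ≠ y ∧
  G.Adj u v ∧ G.Adj v x ∧ G.Adj x y ∧ G.Adj y u ∧ ¬ G.Adj u x ∧ ¬ G.Adj v y ∧
  G.neighborSet u \ {y, v} = G.neighborSet v \ {u, x} ∧
  G.neighborSet x \ {v, y} = G.neighborSet y \ {x, u}

/-- A congruent vertex of III-type: a vertex of some congruent quadrangle. -/
def IIITypeVertex (G : SimpleGraph V) (z : V) : Prop :=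
  ∃ u v x y, CongruentQuad G u v x y ∧ (z = u ∨ z = v ∨ z = x ∨ z = y)

/-- Membership in `𝒢_1^s(n)`: a connected graph obtained by adding a congruent vertex
of I-type to some graph in `𝒢^{s-1}(n-1)`. -/
def memG1 {n : ℕ} (s : ℕ) (G : SimpleGraph (Fin n)) : Prop :=
  G.Connected ∧ ∃ v : Fin n, ITypeVertex G v ∧ memClass (s - 1) (G.induce {v}ᶜ)

/-- Membership in `𝒢_2^s(n)`. -/
def memG2 {n : ℕ} (s : ℕ) (G : SimpleGraph (Fin n)) : Prop :=
  G.Connected ∧ ∃ v : Fin n, IITypeVertex G v ∧ memClass (s - 1) (G.induce {v}ᶜ)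

/-- Membership in `𝒢_3^s(n)`. -/
def memG3 {n : ℕ} (s : ℕ) (G : SimpleGraph (Fin n)) : Prop :=
  G.Connected ∧ ∃ v : Fin n, IIITypeVertex G v ∧ memClass (s - 1) (G.induce {v}ᶜ)

/-- Oboudi's graph `G_m`: two cliques `K_{⌈m/2⌉}` (on `v_1, …`) and `K_{⌊m/2⌋}`
(on `w_1, …`), where `v_i ∼ w_j` iff `j ≥ ⌊m/2⌋ - i + 2` (1-indexed), i.e. (0-indexed)
`⌊m/2⌋ ≤ i + j`. -/
def oboudi (m : ℕ) : SimpleGraph (Fin ((m + 1) / 2) ⊕ Fin (m / 2)) :=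
  SimpleGraph.fromRel fun a b =>
    match a, b with
    | Sum.inl _, Sum.inl _ => True
    | Sum.inr _, Sum.inr _ => True
    | Sum.inl i, Sum.inr j => m / 2 ≤ (i : ℕ) + (j : ℕ)
    | Sum.inr _, Sum.inl _ => False

/-- The generalized lexicographic product `G[K_{t v}]`: each vertex `v` is replaced by a
clique of order `t v`, with complete joins along edges of `G`. -/
def lexProd (G : SimpleGraph V) (t : V → ℕ) : SimpleGraph (Σ v : V, Fin (t v)) :=
  SimpleGraph.fromRel fun a b => a.1 = b.1 ∨ G.Adj a.1 b.1

/-- Index conversion identifying the vertices `v_1, …, v_{⌈k/2⌉}, w_1, …, w_{⌊k/2⌋}`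
of `G_k` with `Fin k` (in this order). -/
def toIdx {k : ℕ} : Fin ((k + 1) / 2) ⊕ Fin (k / 2) → Fin k
  | Sum.inl i => ⟨(i : ℕ), by have := i.isLt; omega⟩
  | Sum.inr j => ⟨(k + 1) / 2 + (j : ℕ), by have := j.isLt; omega⟩

/-- `B_k(n_1, …, n_k) = G_k[K_{n_1}, …, K_{n_k}]`. -/
def bGraph (k : ℕ) (nn : Fin k → ℕ) :
    SimpleGraph (Σ v : Fin ((k + 1) / 2) ⊕ Fin (k / 2), Fin (nn (toIdx v))) :=
  lexProd (oboudi k) fun v => nn (toIdx v)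

/-- Membership in `𝓓* = {B_k(n_1,…,n_k) ∈ 𝓑_k^{00}(n) : 4 ≤ k ≤ 14, n ≤ 14}` (up to
isomorphism). -/
def memDstar {n : ℕ} (G : SimpleGraph (Fin n)) : Prop :=
  ∃ (k : ℕ) (nn : Fin k → ℕ), 4 ≤ k ∧ k ≤ 14 ∧ (∀ i, 1 ≤ nn i) ∧ (∑ i, nn i) ≤ 14 ∧
    lam (bGraph k nn) 3 = 0 ∧ lam (bGraph k nn) 4 = 0 ∧ Nonempty (G ≃g bGraph k nn)

/-- The degree of a vertex. -/
noncomputable def deg [Finite V] (G : SimpleGraph V) (v : V) : ℕ :=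
  Nat.card (G.neighborSet v)

/-- `v` is a vertex of minimum degree. -/
def IsMinDegVertex [Finite V] (G : SimpleGraph V) (v : V) : Prop :=
  ∀ w, deg G v ≤ deg G w

/-- The set `Y = V(G) ∖ N[v]`. -/
def Yset (G : SimpleGraph V) (v : V) : Set V :=
  (G.neighborSet v ∪ {v})ᶜ

/-- `G` is `X`-complete with respect to `v`: `G[Y] ≅ K_{n-t-1}` with `n-t-1 ≥ 2`
and `G[X]` is complete, where `X = N(v)`, `Y = V(G) ∖ N[v]`. -/
def IsXComplete [Finite V] (G : SimpleGraph V) (v : V) : Prop :=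
  2 ≤ (Yset G v).ncard ∧ (Yset G v).Pairwise G.Adj ∧ (G.neighborSet v).Pairwise G.Adj

/-- An `X`-complete graph is reduced when the traces on `Y` of the neighbourhoods of
vertices of `X` form a chain. -/
def IsReduced (G : SimpleGraph V) (v : V) : Prop :=
  ∀ x ∈ G.neighborSet v, ∀ x' ∈ G.neighborSet v,
    G.neighborSet x ∩ Yset G v ⊆ G.neighborSet x' ∩ Yset G v ∨
    G.neighborSet x' ∩ Yset G v ⊆ G.neighborSet x ∩ Yset G v

/-- The quadratic form of the adjacency matrix diagonalises. -/
lemma exists_diag {U : Type*} [Fintype U] [DecidableEq U] (A : Matrix U U ℝ) (hA : A.IsHermitian) :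
    ∃ P Q : Matrix U U ℝ, Q * P = 1 ∧ P * Q = 1 ∧
      Pᵀ * A * P = Matrix.diagonal hA.eigenvalues := by
  have hU := hA.eigenvectorUnitary.2
  rw [Matrix.mem_unitaryGroup_iff'] at hU
  have hs : star (hA.eigenvectorUnitary : Matrix U U ℝ)
      = (hA.eigenvectorUnitary : Matrix U U ℝ)ᵀ := by
    rw [Matrix.star_eq_conjTranspose, Matrix.conjTranspose_eq_transpose_of_trivial]
  refine ⟨hA.eigenvectorUnitary, star (hA.eigenvectorUnitary : Matrix U U ℝ), hU,
    mul_eq_one_comm.mp hU, ?_⟩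
  have h := hA.spectral_theorem
  rw [Unitary.conjStarAlgAut_apply] at h
  rw [← hs]
  generalize (hA.eigenvectorUnitary : Matrix U U ℝ) = P at hU h ⊢
  have h2 : star P * A * P = star P * (P * Matrix.diagonal (RCLike.ofReal ∘ hA.eigenvalues)
      * star P) * P := congrArg (fun Z => star P * Z * P) h
  rw [h2]
  simp only [← mul_assoc]
  rw [hU, one_mul, mul_assoc, hU, mul_one]
  rfl

lemma quad_congr {U W : Type*} [Fintype U] [Fintype W] (A : Matrix U U ℝ) (P : Matrix U W ℝ)
    (c : W → ℝ) :
    (P *ᵥ c) ⬝ᵥ (A *ᵥ (P *ᵥ c)) = c ⬝ᵥ ((Pᵀ * A * P) *ᵥ c) := by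
  rw [← Matrix.mulVec_mulVec, ← Matrix.mulVec_mulVec, Matrix.dotProduct_mulVec c Pᵀ,
    Matrix.vecMul_transpose]

lemma diag_quad {U : Type*} [Fintype U] [DecidableEq U] (d c : U → ℝ) :
    c ⬝ᵥ (Matrix.diagonal d *ᵥ c) = ∑ i, d i * c i ^ 2 := by
  simp only [dotProduct, Matrix.mulVec_diagonal]
  exact Finset.sum_congr rfl fun i _ => by ring

lemma finrank_le_pos {U : Type*} [Fintype U] [DecidableEq U] (A : Matrix U U ℝ)
    (hA : A.IsHermitian) {E : Type*} [AddCommGroup E] [Module ℝ E] [FiniteDimensional ℝ E]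
    (T : E →ₗ[ℝ] (U → ℝ)) (hT : ∀ e, e ≠ 0 → 0 < (T e) ⬝ᵥ (A *ᵥ (T e))) :
    Module.finrank ℝ E ≤ Nat.card {i : U // 0 < hA.eigenvalues i} := by
  classical
  obtain ⟨P, Q, -, hPQ, hD⟩ := exists_diag A hA
  by_contra hlt
  push Not at hlt
  let S : E →ₗ[ℝ] ({i : U // 0 < hA.eigenvalues i} → ℝ) :=
    (LinearMap.funLeft ℝ ℝ Subtype.val).comp ((Matrix.mulVecLin Q).comp T)
  have hker : LinearMap.ker S ≠ ⊥ := by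
    apply LinearMap.ker_ne_bot_of_finrank_lt
    rwa [Module.finrank_fintype_fun_eq_card, ← Nat.card_eq_fintype_card]
  obtain ⟨e, heS, he⟩ := Submodule.exists_mem_ne_zero_of_ne_bot hker
  have h1 := hT e he
  have h2 : T e = P *ᵥ (Q *ᵥ T e) := by rw [Matrix.mulVec_mulVec, hPQ, Matrix.one_mulVec]
  rw [h2, quad_congr, hD, diag_quad] at h1
  refine absurd h1 (not_lt.mpr (Finset.sum_nonpos fun i _ => ?_))
  by_cases hi : 0 < hA.eigenvalues i
  · have : (Q *ᵥ T e) i = 0 := congrFun (LinearMap.mem_ker.mp heS) ⟨i, hi⟩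
    simp [this]
  · exact mul_nonpos_of_nonpos_of_nonneg (not_lt.mp hi) (sq_nonneg _)

lemma exists_pos_map {U : Type*} [Fintype U] [DecidableEq U] (A : Matrix U U ℝ)
    (hA : A.IsHermitian) :
    ∃ T : ({i : U // 0 < hA.eigenvalues i} → ℝ) →ₗ[ℝ] (U → ℝ),
      ∀ e, e ≠ 0 → 0 < (T e) ⬝ᵥ (A *ᵥ (T e)) := by
  classical
  obtain ⟨P, Q, -, hPQ, hD⟩ := exists_diag A hA
  let X : ({i : U // 0 < hA.eigenvalues i} → ℝ) →ₗ[ℝ] (U → ℝ) :=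
    { toFun := fun c i => if h : 0 < hA.eigenvalues i then c ⟨i, h⟩ else 0
      map_add' := by intro a b; ext i; by_cases h : 0 < hA.eigenvalues i <;> simp [h]
      map_smul' := by intro a b; ext i; by_cases h : 0 < hA.eigenvalues i <;> simp [h] }
  refine ⟨(Matrix.mulVecLin P).comp X, fun e he => ?_⟩
  change 0 < (P *ᵥ X e) ⬝ᵥ (A *ᵥ (P *ᵥ X e))
  rw [quad_congr, hD, diag_quad]
  obtain ⟨j, hj⟩ := Function.ne_iff.mp he
  apply Finset.sum_pos'
  · intro i _
    by_cases h : 0 < hA.eigenvalues i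
    · positivity
    · simp [X, h]
  · refine ⟨j.1, Finset.mem_univ _, mul_pos j.2 ?_⟩
    have : X e j.1 = e j := by simp [X, j.2]
    rw [this]
    have : e j ≠ 0 := hj
    positivity

lemma pos_le_of_congr {U W : Type*} [Fintype U] [DecidableEq U] [Fintype W] [DecidableEq W]
    (A : Matrix U U ℝ) (hA : A.IsHermitian) (B : Matrix W W ℝ) (hB : B.IsHermitian)
    (M : Matrix W U ℝ) (h : A = Mᵀ * B * M) :
    Nat.card {i : U // 0 < hA.eigenvalues i} ≤ Nat.card {i : W // 0 < hB.eigenvalues i} := by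
  classical
  obtain ⟨T, hT⟩ := exists_pos_map A hA
  have := finrank_le_pos B hB ((Matrix.mulVecLin M).comp T) (fun e he => by
    change 0 < (M *ᵥ T e) ⬝ᵥ (B *ᵥ (M *ᵥ T e))
    rw [quad_congr, ← h]
    exact hT e he)
  rwa [Module.finrank_fintype_fun_eq_card, ← Nat.card_eq_fintype_card] at this

lemma rank_le_of_congr {U W : Type*} [Fintype U] [Fintype W] [DecidableEq W]
    (A : Matrix U U ℝ) (B : Matrix W W ℝ)
    (M : Matrix W U ℝ) (h : A = Mᵀ * B * M) : A.rank ≤ B.rank := by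
  rw [h]
  exact (Matrix.rank_mul_le_left _ _).trans (Matrix.rank_mul_le_right _ _)

lemma null_add_rank {U : Type*} [Fintype U] [DecidableEq U] (A : Matrix U U ℝ)
    (hA : A.IsHermitian) :
    Nat.card {i : U // hA.eigenvalues i = 0} + A.rank = Fintype.card U := by
  classical
  rw [hA.rank_eq_card_non_zero_eigs, Nat.card_eq_fintype_card, Fintype.card_subtype_compl]
  have := Fintype.card_subtype_le (fun i => hA.eigenvalues i = 0)
  omega

lemma posCount_eq {U : Type*} [i1 : Fintype U] [i2 : DecidableEq U] (G : SimpleGraph U) :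
    posCount G = Nat.card {i : U // 0 < (adjMat_isHermitian G).eigenvalues i} := by
  unfold posCount eigs
  have h1 : Fintype.ofFinite U = i1 := Subsingleton.elim _ _
  have h2 : Classical.decEq U = i2 := Subsingleton.elim _ _
  generalize Fintype.ofFinite U = j1 at h1 ⊢
  generalize Classical.decEq U = j2 at h2 ⊢
  subst h1 h2
  rfl

lemma nullCount_eq {U : Type*} [i1 : Fintype U] [i2 : DecidableEq U] (G : SimpleGraph U) :
    nullCount G = Nat.card {i : U // (adjMat_isHermitian G).eigenvalues i = 0} := by
  unfold nullCount eigs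
  have h1 : Fintype.ofFinite U = i1 := Subsingleton.elim _ _
  have h2 : Classical.decEq U = i2 := Subsingleton.elim _ _
  generalize Fintype.ofFinite U = j1 at h1 ⊢
  generalize Classical.decEq U = j2 at h2 ⊢
  subst h1 h2
  rfl

/-- Deleting a vertex in the support of a null vector. -/
lemma memClass_delete {U : Type*} [Fintype U] [DecidableEq U] (G : SimpleGraph U) (s : ℕ)
    (hG : memClass s G) (f : U → ℝ) (hf : adjMat G *ᵥ f = 0) (y : U) (hy : f y ≠ 0) :
    memClass (s - 1) (G.induce {y}ᶜ) := by
  classical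
  set A := adjMat G with hAdef
  set B := adjMat (G.induce {y}ᶜ) with hBdef
  have hsymm : Aᵀ = A := by
    have := adjMat_isHermitian G
    rwa [Matrix.IsHermitian, Matrix.conjTranspose_eq_transpose_of_trivial] at this
  let N : Matrix U ({y}ᶜ : Set U) ℝ := (1 : Matrix U U ℝ).submatrix id Subtype.val
  let R : Matrix U U ℝ := 1 - Matrix.vecMulVec f (Pi.single y (f y)⁻¹)
  let M : Matrix ({y}ᶜ : Set U) U ℝ := R.submatrix Subtype.val id
  have hB : B = Nᵀ * A * N := by
    ext i j
    have : B i j = A i.1 j.1 := by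
      simp [hBdef, hAdef, adjMat, SimpleGraph.adjMatrix_apply]
    rw [this]
    simp [N, Matrix.mul_apply, Matrix.one_apply]
  have hNM : N * M = R := by
    ext i j
    by_cases hi : i = y
    · subst hi
      have h1 : R i j = 0 := by
        by_cases hj : j = i
        · subst hj; simp [R, Matrix.vecMulVec_apply, hy]
        · simp [R, Matrix.vecMulVec_apply, hj, Matrix.one_apply, Ne.symm hj]
      rw [h1, Matrix.mul_apply]
      refine Finset.sum_eq_zero fun k _ => ?_
      have : i ≠ k.1 := fun h => k.2 h.symm
      simp [N, Matrix.one_apply, this]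
    · rw [Matrix.mul_apply, Finset.sum_eq_single (⟨i, hi⟩ : ({y}ᶜ : Set U))]
      · have : N i ⟨i, hi⟩ = 1 := Matrix.one_apply_eq i
        rw [this, one_mul]
        rfl
      · intro k _ hk
        have : i ≠ k.1 := fun h => hk (Subtype.ext h.symm)
        simp [N, Matrix.one_apply, this]
      · simp
  have hAR : A * R = A := by
    simp only [R, mul_sub, mul_one, Matrix.mul_vecMulVec, hf]
    simp
  have hA : A = Mᵀ * B * M := by
    have h1 : Mᵀ * B * M = Rᵀ * (A * R) := by
      rw [hB, ← hNM, Matrix.transpose_mul]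
      simp only [Matrix.mul_assoc]
    rw [h1, hAR]
    have := congrArg Matrix.transpose hAR
    rw [Matrix.transpose_mul, hsymm] at this
    exact this.symm
  have hr : A.rank = B.rank := le_antisymm (rank_le_of_congr A B M hA) (rank_le_of_congr B A N hB)
  have hp := le_antisymm
    (pos_le_of_congr A (adjMat_isHermitian G) B (adjMat_isHermitian _) M hA)
    (pos_le_of_congr B (adjMat_isHermitian _) A (adjMat_isHermitian G) N hB)
  have n1 := null_add_rank A (adjMat_isHermitian G)
  have n2 := null_add_rank B (adjMat_isHermitian _)
  obtain ⟨g1, g2⟩ := hG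
  rw [posCount_eq] at g1
  rw [nullCount_eq] at g2
  refine ⟨?_, ?_⟩
  · rw [posCount_eq, ← hp, g1]
  · rw [nullCount_eq]
    have hc : Fintype.card ({y}ᶜ : Set U) = Fintype.card U - 1 := by
      rw [Fintype.card_compl_set]; simp
    have : 0 < Fintype.card U := Fintype.card_pos_iff.mpr ⟨y⟩
    rw [g2] at n1
    omega

/-- Three positive directions from two positive vectors and an isotropic nonnull vector. -/
lemma three_le {U : Type*} [Fintype U] [DecidableEq U] (A : Matrix U U ℝ)
    (hA : A.IsHermitian) (p q f w : U → ℝ)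
    (hp : 0 < p ⬝ᵥ (A *ᵥ p)) (hq : 0 < q ⬝ᵥ (A *ᵥ q)) (hpq : p ⬝ᵥ (A *ᵥ q) = 0)
    (hpf : p ⬝ᵥ (A *ᵥ f) = 0) (hqf : q ⬝ᵥ (A *ᵥ f) = 0) (hff : f ⬝ᵥ (A *ᵥ f) = 0)
    (hwf : w ⬝ᵥ (A *ᵥ f) ≠ 0) :
    3 ≤ Nat.card {i : U // 0 < hA.eigenvalues i} := by
  classical
  have hsymm : Aᵀ = A := by
    rwa [Matrix.IsHermitian, Matrix.conjTranspose_eq_transpose_of_trivial] at hA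
  have comm : ∀ a b : U → ℝ, a ⬝ᵥ (A *ᵥ b) = b ⬝ᵥ (A *ᵥ a) := by
    intro a b
    rw [Matrix.dotProduct_mulVec, ← Matrix.mulVec_transpose, hsymm, dotProduct_comm]
  set a := p ⬝ᵥ (A *ᵥ p) with ha
  set b := q ⬝ᵥ (A *ᵥ q) with hb
  set e := w ⬝ᵥ (A *ᵥ f) with he
  set α := p ⬝ᵥ (A *ᵥ w) with hα
  set β := q ⬝ᵥ (A *ᵥ w) with hβ
  have c1 := comm q p
  have c2 := comm f p
  have c3 := comm f q
  have c4 := comm f w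
  have c5 := comm w p
  have c6 := comm w q
  rw [hpq] at c1
  rw [hpf] at c2
  rw [hqf] at c3
  let w' := w - (α / a) • p - (β / b) • q
  set γ := w' ⬝ᵥ (A *ᵥ w') with hγ
  let u := w' + ((1 - γ) / (2 * e)) • f
  have hpw' : p ⬝ᵥ (A *ᵥ w') = 0 := by
    simp only [w', Matrix.mulVec_sub, Matrix.mulVec_smul, dotProduct_sub, dotProduct_smul,
      smul_eq_mul, hpq, ← ha, ← hα]
    field_simp; ring
  have hqw' : q ⬝ᵥ (A *ᵥ w') = 0 := by
    simp only [w', Matrix.mulVec_sub, Matrix.mulVec_smul, dotProduct_sub, dotProduct_smul,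
      smul_eq_mul, c1, ← hb, ← hβ]
    field_simp; ring
  have hfw' : f ⬝ᵥ (A *ᵥ w') = e := by
    simp only [w', Matrix.mulVec_sub, Matrix.mulVec_smul, dotProduct_sub, dotProduct_smul,
      smul_eq_mul, c2, c3, c4, ← he]
    ring
  have hpu : p ⬝ᵥ (A *ᵥ u) = 0 := by
    simp [u, Matrix.mulVec_add, Matrix.mulVec_smul, hpw', hpf]
  have hqu : q ⬝ᵥ (A *ᵥ u) = 0 := by
    simp [u, Matrix.mulVec_add, Matrix.mulVec_smul, hqw', hqf]
  have huu : u ⬝ᵥ (A *ᵥ u) = 1 := by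
    simp only [u, Matrix.mulVec_add, Matrix.mulVec_smul, dotProduct_add, dotProduct_smul,
      add_dotProduct, smul_dotProduct, smul_eq_mul, hff, hfw', comm w' f, ← hγ]
    field_simp; ring
  have c7 := comm u p
  have c8 := comm u q
  rw [hpu] at c7
  rw [hqu] at c8
  let T : (Fin 3 → ℝ) →ₗ[ℝ] (U → ℝ) :=
    { toFun := fun c => c 0 • p + c 1 • q + c 2 • u
      map_add' := by intro x z; ext i; simp; ring
      map_smul' := by intro x z; ext i; simp; ring }
  have hT : ∀ c, (T c) ⬝ᵥ (A *ᵥ (T c)) = c 0 ^ 2 * a + c 1 ^ 2 * b + c 2 ^ 2 := by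
    intro c
    change (c 0 • p + c 1 • q + c 2 • u) ⬝ᵥ (A *ᵥ (c 0 • p + c 1 • q + c 2 • u)) = _
    simp only [Matrix.mulVec_add, Matrix.mulVec_smul, dotProduct_add, dotProduct_smul,
      add_dotProduct, smul_dotProduct, smul_eq_mul, hpq, hpu, hqu, huu, c1, c7, c8, ← ha, ← hb]
    ring
  have := finrank_le_pos A hA T (fun c hc => by
    rw [hT]
    obtain ⟨j, hj⟩ := Function.ne_iff.mp hc
    have hj' : c j ≠ 0 := hj
    have : 0 < c j ^ 2 := by positivity
    fin_cases j
    · have : 0 < c 0 ^ 2 := this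
      positivity
    · have : 0 < c 1 ^ 2 := this
      positivity
    · have : 0 < c 2 ^ 2 := this
      positivity)
  simpa using this

lemma dot_single {U : Type*} [Fintype U] [DecidableEq U] (A : Matrix U U ℝ) (i j : U) :
    (Pi.single i 1 : U → ℝ) ⬝ᵥ (A *ᵥ (Pi.single j 1 : U → ℝ)) = A i j := by
  simp

lemma adj_one {U : Type*} [Fintype U] [DecidableEq U] {G : SimpleGraph U} {i j : U}
    (h : G.Adj i j) : adjMat G i j = 1 := by
  simp [adjMat, SimpleGraph.adjMatrix_apply, h]

lemma adj_zero {U : Type*} [Fintype U] [DecidableEq U] {G : SimpleGraph U} {i j : U}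
    (h : ¬ G.Adj i j) : adjMat G i j = 0 := by
  simp [adjMat, SimpleGraph.adjMatrix_apply, h]

/-- The key step: the null vector of the bull / path on five vertices is null for `G`. -/
lemma key {U : Type*} [Fintype U] [DecidableEq U] (G : SimpleGraph U) (hG : posCount G = 2)
    (v x y z y' : U) (hvx : G.Adj v x) (hxy : G.Adj x y) (hyz : G.Adj y z) (hzy' : G.Adj z y')
    (hxy' : ¬ G.Adj x y') (hvy : ¬ G.Adj v y) (hvz : ¬ G.Adj v z) (hvy' : ¬ G.Adj v y')
    (hyy' : ¬ G.Adj y y') :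
    adjMat G *ᵥ ((Pi.single y 1 : U → ℝ) - Pi.single y' 1 - Pi.single v 1) = 0 := by
  classical
  by_contra hne
  obtain ⟨w, hw⟩ := Function.ne_iff.mp hne
  have d := dot_single (adjMat G)
  obtain ⟨t, ht, ht0, ht1⟩ : ∃ t, adjMat G x z = t ∧ 0 ≤ t ∧ t ≤ 1 := by
    by_cases h : G.Adj x z
    · exact ⟨1, adj_one h, by norm_num, le_refl _⟩
    · exact ⟨0, adj_zero h, le_refl _, by norm_num⟩
  have ht' : adjMat G z x = t := by
    rw [← ht]
    by_cases h : G.Adj x z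
    · rw [adj_one h, adj_one h.symm]
    · rw [adj_zero h, adj_zero (fun h' => h h'.symm)]
  have sy : ∀ {i j}, ¬ G.Adj i j → ¬ G.Adj j i := fun h h' => h h'.symm
  have e1 := adj_one hvx
  have e2 := adj_one hvx.symm
  have e3 := adj_one hxy
  have e4 := adj_one hxy.symm
  have e5 := adj_one hyz
  have e6 := adj_one hyz.symm
  have e7 := adj_one hzy'
  have e8 := adj_one hzy'.symm
  have f1 := adj_zero hxy'
  have f2 := adj_zero (sy hxy')
  have f3 := adj_zero hvy
  have f4 := adj_zero (sy hvy)
  have f5 := adj_zero hvz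
  have f6 := adj_zero (sy hvz)
  have f7 := adj_zero hvy'
  have f8 := adj_zero (sy hvy')
  have f9 := adj_zero hyy'
  have f10 := adj_zero (sy hyy')
  have l1 := adj_zero (G.loopless.irrefl v)
  have l2 := adj_zero (G.loopless.irrefl x)
  have l3 := adj_zero (G.loopless.irrefl y)
  have l4 := adj_zero (G.loopless.irrefl z)
  have l5 := adj_zero (G.loopless.irrefl y')
  let P : U → ℝ := Pi.single v 1 + Pi.single x 1
  let Q : U → ℝ := Pi.single z 1 + Pi.single y' 1 - (t / 2) • (Pi.single v 1 + Pi.single x 1)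
  have := three_le (adjMat G) (adjMat_isHermitian G) P Q
    ((Pi.single y 1 : U → ℝ) - Pi.single y' 1 - Pi.single v 1) (Pi.single w 1)
    (by
      simp only [P, Matrix.mulVec_add, dotProduct_add, add_dotProduct, d, e1, e2, l1, l2]
      norm_num)
    (by
      simp only [Q, Matrix.mulVec_add, Matrix.mulVec_sub, Matrix.mulVec_smul, dotProduct_add,
        dotProduct_sub, sub_dotProduct, dotProduct_smul, smul_dotProduct, add_dotProduct, d,
        smul_eq_mul, e1, e2, e3, e4, e5, e6, e7, e8, f1, f2, f3, f4, f5, f6, f7, f8, l1, l2, l4,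
        l5, ht, ht']
      nlinarith)
    (by
      simp only [P, Q, Matrix.mulVec_add, Matrix.mulVec_sub, Matrix.mulVec_smul, dotProduct_add,
        dotProduct_sub, sub_dotProduct, dotProduct_smul, smul_dotProduct, add_dotProduct, d,
        smul_eq_mul, e1, e2, e3, e4, e5, e6, e7, e8, f1, f2, f3, f4, f5, f6, f7, f8, l1, l2, l4,
        l5, ht, ht']
      ring)
    (by
      simp only [P, Matrix.mulVec_sub, dotProduct_sub, add_dotProduct, d,
        e2, e3, f1, f3, f7, l1]
      ring)
    (by
      simp only [Q, Matrix.mulVec_sub, dotProduct_sub, sub_dotProduct, smul_dotProduct,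
        smul_eq_mul, add_dotProduct, d, e2, e3, e6, e7, f1, f3, f6, f7, f8, f10, l1, l5]
      ring)
    (by
      simp only [Matrix.mulVec_sub, dotProduct_sub, sub_dotProduct, d,
        f3, f4, f7, f8, f9, f10, l1, l3, l5]
      ring)
    (by
      rw [single_dotProduct, one_mul]
      exact hw)
  rw [← posCount_eq, hG] at this
  omega

lemma memG2_of {n s : ℕ} (G : SimpleGraph (Fin n)) (hconn : G.Connected) (hG : memClass s G)
    (v x y z y' : Fin n) (hvx : G.Adj v x) (hxy : G.Adj x y) (hyz : G.Adj y z)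
    (hzy' : G.Adj z y')
    (hxy' : ¬ G.Adj x y') (hvy : ¬ G.Adj v y) (hvz : ¬ G.Adj v z) (hvy' : ¬ G.Adj v y')
    (hyy' : ¬ G.Adj y y') (hne : y ≠ y') (hyv : y ≠ v) (hy'v : y' ≠ v) : memG2 s G := by
  have hf := key G hG.1 v x y z y' hvx hxy hyz hzy' hxy' hvy hvz hvy' hyy'
  have hw : ∀ w, adjMat G w y = adjMat G w y' + adjMat G w v := by
    intro w
    have := congrFun hf w
    simp [Matrix.mulVec_sub] at this
    linarith
  refine ⟨hconn, y, ⟨y', v, hy'v, fun h => hvy' h.symm, ?_, ?_⟩,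
    memClass_delete G s hG _ hf y ?_⟩
  · rw [Set.disjoint_left]
    intro w h1 h2
    have a1 : G.Adj w y' := (show G.Adj y' w from h1).symm
    have a2 : G.Adj w v := (show G.Adj v w from h2).symm
    have := hw w
    rw [adj_one a1, adj_one a2] at this
    by_cases h : G.Adj w y
    · rw [adj_one h] at this; norm_num at this
    · rw [adj_zero h] at this; norm_num at this
  · ext w
    simp only [SimpleGraph.mem_neighborSet, Set.mem_union]
    rw [G.adj_comm y, G.adj_comm y', G.adj_comm v]
    have := hw w
    by_cases h : G.Adj w y <;> by_cases h1 : G.Adj w y' <;> by_cases h2 : G.Adj w v <;>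
      simp [adj_one, adj_zero, h, h1, h2] at this ⊢
    norm_num at this
  · simp [hne, hyv]

theorem Y_multipartite_dichotomy {n s : ℕ} (hs : 2 ≤ s) (hsn : s ≤ n - 3)
    (G : SimpleGraph (Fin n)) (hconn : G.Connected) (hG : memClass s G)
    (v : Fin n) (hv : IsMinDegVertex G v)
    (X Y : Set (Fin n)) (hX : X = G.neighborSet v) (hY : Y = Yset G v)
    (hstr : ∃ (l : ℕ) (nn : Fin l → ℕ), 2 ≤ l ∧ (∀ i, 1 ≤ nn i) ∧
      Nonempty ((G.induce Y) ≃g (SimpleGraph.completeMultipartiteGraph fun i => Fin (nn i))))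
    (y y' : Fin n) (hy : y ∈ Y) (hy' : y' ∈ Y) (hne : y ≠ y') (hnadj : ¬ G.Adj y y') :
    (G.neighborSet y ∩ X = G.neighborSet y' ∩ X → memG1 s G) ∧
    (G.neighborSet y ∩ X ≠ G.neighborSet y' ∩ X → memG2 s G) := by
  obtain ⟨l, nn, hl, hnn, ⟨φ⟩⟩ := hstr
  have hadj : ∀ (a b : Y), G.Adj a.1 b.1 ↔ (φ a).1 ≠ (φ b).1 := by
    intro a b
    have h := φ.map_rel_iff (a := a) (b := b)
    exact h.symm
  have hsame : (φ ⟨y, hy⟩).1 = (φ ⟨y', hy'⟩).1 := by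
    by_contra h
    exact hnadj ((hadj ⟨y, hy⟩ ⟨y', hy'⟩).mpr h)
  have hYmem : ∀ w, w ∈ Y ↔ ¬ G.Adj v w ∧ w ≠ v := by
    intro w
    rw [hY, Yset]
    simp
    tauto
  -- a vertex of `Y` in another part
  obtain ⟨z, hz, hyz, hzy'⟩ : ∃ z ∈ Y, G.Adj y z ∧ G.Adj z y' := by
    have : Nontrivial (Fin l) := Fin.nontrivial_iff_two_le.mpr hl
    obtain ⟨j, hj⟩ := exists_ne (φ ⟨y, hy⟩).1
    let m : Σ i, Fin (nn i) := ⟨j, ⟨0, hnn j⟩⟩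
    let zz := φ.symm m
    have hzz : φ zz = m := φ.apply_symm_apply m
    refine ⟨zz.1, zz.2, (hadj ⟨y, hy⟩ zz).mpr ?_, (hadj zz ⟨y', hy'⟩).mpr ?_⟩
    · rw [hzz]; exact hj.symm
    · rw [hzz, ← hsame]; exact hj
  obtain ⟨hvy, hyv⟩ := (hYmem y).mp hy
  obtain ⟨hvy', hy'v⟩ := (hYmem y').mp hy'
  obtain ⟨hvz, -⟩ := (hYmem z).mp hz
  subst hX
  constructor
  · intro h
    have hN : G.neighborSet y = G.neighborSet y' := by
      ext w
      simp only [SimpleGraph.mem_neighborSet]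
      by_cases h1 : G.Adj v w
      · have := Set.ext_iff.mp h w
        simpa [h1] using this
      · by_cases h2 : w = v
        · subst h2
          exact ⟨fun h => (hvy h.symm).elim, fun h => (hvy' h.symm).elim⟩
        · have hw : w ∈ Y := (hYmem w).mpr ⟨h1, h2⟩
          rw [hadj ⟨y, hy⟩ ⟨w, hw⟩, hadj ⟨y', hy'⟩ ⟨w, hw⟩, hsame]
    refine ⟨hconn, y', ⟨y, hne, hnadj, hN⟩,
      memClass_delete G s hG (Pi.single y 1 - Pi.single y' 1) ?_ y' ?_⟩
    · ext w
      have hw : G.Adj w y ↔ G.Adj w y' := by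
        rw [G.adj_comm w, G.adj_comm w]
        exact Set.ext_iff.mp hN w
      by_cases h : G.Adj w y'
      · simp [Matrix.mulVec_sub, adj_one h, adj_one (hw.mpr h)]
      · simp [Matrix.mulVec_sub, adj_zero h, adj_zero (fun h' => h (hw.mp h'))]
    · simp [hne.symm]
  · intro h
    have : ∃ x, G.Adj v x ∧ ((G.Adj x y ∧ ¬ G.Adj x y') ∨ (G.Adj x y' ∧ ¬ G.Adj x y)) := by
      by_contra hcon
      push Not at hcon
      apply h
      ext x
      simp only [Set.mem_inter_iff, SimpleGraph.mem_neighborSet]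
      rw [G.adj_comm y, G.adj_comm y']
      have := hcon x
      tauto
    obtain ⟨x, hvx, ⟨h1, h2⟩ | ⟨h1, h2⟩⟩ := this
    · exact memG2_of G hconn hG v x y z y' hvx h1 hyz hzy' h2 hvy hvz hvy' hnadj hne hyv hy'v
    · exact memG2_of G hconn hG v x y' z y hvx h1 hzy'.symm hyz.symm h2 hvy' hvz hvy
        (fun h => hnadj h.symm) hne.symm hy'v hyv

end TwoPosEig
end

section
/- Let G ∈ 𝒞𝒢^s(n) with 2 ≤ s ≤ n−3 be a reduced X-complete graph. Then there exists an integer k with 4 ≤ k ≤ 14 and positive integers n_1,…,n_k such that G ≅ G_k[K_{n_1},…,K_{n_k}]. -/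
open Matrix BigOperators

namespace TwoPosEig

variable {V : Type*}

section Spectral
variable {V : Type*} [Fintype V] [DecidableEq V]

lemma quad_eigen {A : Matrix V V ℝ} (hA : A.IsHermitian) (c : V → ℝ) :
    ((hA.eigenvectorUnitary : Matrix V V ℝ) *ᵥ c) ⬝ᵥ
      (A *ᵥ ((hA.eigenvectorUnitary : Matrix V V ℝ) *ᵥ c)) =
    ∑ i, hA.eigenvalues i * c i ^ 2 := by
  have h1 : A * (hA.eigenvectorUnitary : Matrix V V ℝ) =
      (hA.eigenvectorUnitary : Matrix V V ℝ) * Matrix.diagonal hA.eigenvalues := by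
    ext i j
    have := congrFun (hA.mulVec_eigenvectorBasis j) i
    rw [Matrix.mul_diagonal, Matrix.mul_apply]
    simp only [Matrix.mulVec, dotProduct, Pi.smul_apply, smul_eq_mul] at this
    simp only [hA.eigenvectorUnitary_apply]
    rw [this, mul_comm]
  have h2 : (hA.eigenvectorUnitary : Matrix V V ℝ)ᵀ * (hA.eigenvectorUnitary : Matrix V V ℝ) = 1 := by
    have := Unitary.coe_star_mul_self hA.eigenvectorUnitary
    rwa [Matrix.star_eq_conjTranspose, Matrix.conjTranspose_eq_transpose_of_trivial] at this
  rw [Matrix.mulVec_mulVec, h1, ← Matrix.mulVec_mulVec, Matrix.dotProduct_mulVec,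
    Matrix.vecMul_mulVec, h2, Matrix.vecMul_one]
  simp only [dotProduct, Matrix.mulVec_diagonal]
  exact Finset.sum_congr rfl fun i _ => by ring

lemma eigen_surj {A : Matrix V V ℝ} (hA : A.IsHermitian) (x : V → ℝ) :
    (hA.eigenvectorUnitary : Matrix V V ℝ) *ᵥ ((hA.eigenvectorUnitary : Matrix V V ℝ)ᵀ *ᵥ x) = x := by
  have := Unitary.coe_mul_star_self hA.eigenvectorUnitary
  rw [Unitary.coe_star, Matrix.star_eq_conjTranspose, Matrix.conjTranspose_eq_transpose_of_trivial] at this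
  rw [Matrix.mulVec_mulVec, this, Matrix.one_mulVec]

lemma eigen_inj {A : Matrix V V ℝ} (hA : A.IsHermitian) (c : V → ℝ)
    (h : (hA.eigenvectorUnitary : Matrix V V ℝ) *ᵥ c = 0) : c = 0 := by
  have := Unitary.coe_star_mul_self hA.eigenvectorUnitary
  have h' := congrArg (fun z => (star (hA.eigenvectorUnitary : Matrix V V ℝ)) *ᵥ z) h
  simpa [Matrix.mulVec_mulVec, this] using h'

lemma card_pos_ge {A : Matrix V V ℝ} (hA : A.IsHermitian) {m : ℕ}
    (L : (Fin m → ℝ) →ₗ[ℝ] (V → ℝ)) (hL : ∀ c, c ≠ 0 → 0 < L c ⬝ᵥ (A *ᵥ L c)) :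
    m ≤ Nat.card {i : V // 0 < hA.eigenvalues i} := by
  classical
  let T : (Fin m → ℝ) →ₗ[ℝ] ({i : V // 0 < hA.eigenvalues i} → ℝ) :=
    (LinearMap.funLeft ℝ ℝ (Subtype.val)) ∘ₗ
      (Matrix.mulVecLin (hA.eigenvectorUnitary : Matrix V V ℝ)ᵀ) ∘ₗ L
  have hT : Function.Injective T := by
    rw [← LinearMap.ker_eq_bot, LinearMap.ker_eq_bot']
    intro c hc
    by_contra hne
    have h := hL c hne
    rw [← eigen_surj hA (L c), quad_eigen] at h
    apply absurd h
    rw [not_lt]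
    apply Finset.sum_nonpos
    intro i _
    by_cases hi : 0 < hA.eigenvalues i
    · have : ((hA.eigenvectorUnitary : Matrix V V ℝ)ᵀ *ᵥ L c) i = 0 := congrFun hc ⟨i, hi⟩
      rw [this]; simp
    · exact mul_nonpos_of_nonpos_of_nonneg (not_lt.mp hi) (sq_nonneg _)
  have := LinearMap.finrank_le_finrank_of_injective hT
  simpa using this

lemma card_nonneg_le {A : Matrix V V ℝ} (hA : A.IsHermitian) {K : Type*} [Fintype K]
    (M : (V → ℝ) →ₗ[ℝ] (K → ℝ)) (hM : ∀ z, M z = 0 → z ⬝ᵥ (A *ᵥ z) + z ⬝ᵥ z = 0) :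
    Nat.card {i : V // 0 ≤ hA.eigenvalues i} ≤ Fintype.card K := by
  classical
  let E : ({i : V // 0 ≤ hA.eigenvalues i} → ℝ) →ₗ[ℝ] (V → ℝ) :=
    Function.ExtendByZero.linearMap ℝ Subtype.val
  let T : ({i : V // 0 ≤ hA.eigenvalues i} → ℝ) →ₗ[ℝ] (K → ℝ) :=
    M ∘ₗ (Matrix.mulVecLin (hA.eigenvectorUnitary : Matrix V V ℝ)) ∘ₗ E
  have hT : Function.Injective T := by
    rw [← LinearMap.ker_eq_bot, LinearMap.ker_eq_bot']
    intro c hc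
    have h := hM _ hc
    change ((hA.eigenvectorUnitary : Matrix V V ℝ) *ᵥ E c) ⬝ᵥ
      (A *ᵥ ((hA.eigenvectorUnitary : Matrix V V ℝ) *ᵥ E c)) +
      ((hA.eigenvectorUnitary : Matrix V V ℝ) *ᵥ E c) ⬝ᵥ
      ((hA.eigenvectorUnitary : Matrix V V ℝ) *ᵥ E c) = 0 at h
    rw [quad_eigen] at h
    have h1 : 0 ≤ ∑ i, hA.eigenvalues i * (E c) i ^ 2 := by
      apply Finset.sum_nonneg
      intro i _
      by_cases hi : 0 ≤ hA.eigenvalues i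
      · positivity
      · have : E c i = 0 := by
          change Function.extend Subtype.val c 0 i = 0
          rw [Function.extend_apply']
          · rfl
          · rintro ⟨⟨a, ha⟩, rfl⟩; exact hi ha
        rw [this]; simp
    have h2 : 0 ≤ ((hA.eigenvectorUnitary : Matrix V V ℝ) *ᵥ E c) ⬝ᵥ
      ((hA.eigenvectorUnitary : Matrix V V ℝ) *ᵥ E c) :=
      Finset.sum_nonneg fun i _ => mul_self_nonneg _
    have h3 := eigen_inj hA _ (dotProduct_self_eq_zero.mp (by linarith))
    ext i
    have := congrFun h3 i.1
    change Function.extend Subtype.val c 0 i.1 = 0 at this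
    rwa [Subtype.val_injective.extend_apply] at this
  have := LinearMap.finrank_le_finrank_of_injective hT
  simpa using this

end Spectral

/-- `φ` presents `G` as a blow-up of `H`. -/
def IsBlow {V K : Type*} (G : SimpleGraph V) (H : SimpleGraph K) (φ : V → K) : Prop :=
  ∀ x y, G.Adj x y ↔ x ≠ y ∧ (φ x = φ y ∨ H.Adj (φ x) (φ y))

lemma adjMat_apply {V : Type*} [Fintype V] [DecidableEq V] (G : SimpleGraph V) (x y : V) :
    adjMat G x y = (open Classical in if G.Adj x y then (1 : ℝ) else 0) := by
  unfold adjMat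
  rw [SimpleGraph.adjMatrix_apply]

lemma blow_card_le {V K : Type*} [Fintype V] [DecidableEq V] [Fintype K] (G : SimpleGraph V)
    (H : SimpleGraph K) (φ : V → K) (h : IsBlow G H φ) :
    Nat.card {i : V // 0 ≤ eigs G i} ≤ Fintype.card K := by
  classical
  let N : Matrix K V ℝ := Matrix.of fun k x => if φ x = k then 1 else 0
  refine card_nonneg_le (adjMat_isHermitian G) (Matrix.mulVecLin N) ?_
  intro z hz
  have hz' : ∀ k, ∑ x, (if φ x = k then z x else 0) = 0 := by
    intro k
    have := congrFun hz k
    simpa [N, Matrix.mulVec, dotProduct] using this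
  have key : ∀ x, (adjMat G *ᵥ z) x + z x = 0 := by
    intro x
    have e : ∀ y, adjMat G x y * z y + (if x = y then z y else 0) =
        ∑ k, (if φ x = k ∨ H.Adj (φ x) k then (if φ y = k then z y else 0) else 0) := by
      intro y
      rw [Finset.sum_eq_single (φ y)]
      · rw [adjMat_apply]
        by_cases hxy : x = y
        · subst hxy; simp
        · simp [h x y, hxy]
      · intro k _ hk; simp [Ne.symm hk]
      · simp
    have : (adjMat G *ᵥ z) x + z x = ∑ y, (adjMat G x y * z y + (if x = y then z y else 0)) := by
      simp [Finset.sum_add_distrib, Matrix.mulVec, dotProduct]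
    rw [this, Finset.sum_congr rfl fun y _ => e y, Finset.sum_comm]
    apply Finset.sum_eq_zero
    intro k _
    by_cases hk : φ x = k ∨ H.Adj (φ x) k
    · simp only [if_pos hk, hz']
    · simp only [if_neg hk, Finset.sum_const_zero]
  rw [← dotProduct_add]
  have : adjMat G *ᵥ z + z = 0 := funext key
  rw [this, dotProduct_zero]

/-- Coefficient vector on `G_15` giving a positive definite 3-space. -/
def coefL (a t : ℝ) : Fin 8 → ℝ := ![a, a + 3 * t, 3 * t, 0, -3 * t, -3 * t, 0, t]
def coefR (b t : ℝ) : Fin 7 → ℝ := ![b + 3 * t, b + 3 * t, 0, -3 * t, -3 * t, 0, 3 * t]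

lemma form15 (a b t : ℝ) :
    (∑ i : Fin 8, ∑ j : Fin 8, if i = j then 0 else coefL a t i * coefL a t j) +
    (∑ i : Fin 7, ∑ j : Fin 7, if i = j then 0 else coefR b t i * coefR b t j) +
    2 * (∑ i : Fin 8, ∑ j : Fin 7, if 7 ≤ (i : ℕ) + (j : ℕ) then coefL a t i * coefR b t j else 0)
    = 2 * (a + t) ^ 2 + 2 * (b + t) ^ 2 + 2 * t ^ 2 := by
  simp only [Fin.sum_univ_succ, coefL, coefR]
  simp [Fin.ext_iff]
  ring


lemma oboudi_ll {k : ℕ} (i j : Fin ((k + 1) / 2)) :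
    (oboudi k).Adj (Sum.inl i) (Sum.inl j) ↔ i ≠ j := by
  simp [oboudi]

lemma oboudi_rr {k : ℕ} (i j : Fin (k / 2)) :
    (oboudi k).Adj (Sum.inr i) (Sum.inr j) ↔ i ≠ j := by
  simp [oboudi]

lemma oboudi_lr {k : ℕ} (i : Fin ((k + 1) / 2)) (j : Fin (k / 2)) :
    (oboudi k).Adj (Sum.inl i) (Sum.inr j) ↔ k / 2 ≤ (i : ℕ) + (j : ℕ) := by
  simp [oboudi]

lemma oboudi_rl {k : ℕ} (i : Fin ((k + 1) / 2)) (j : Fin (k / 2)) :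
    (oboudi k).Adj (Sum.inr j) (Sum.inl i) ↔ k / 2 ≤ (i : ℕ) + (j : ℕ) := by
  simp [oboudi]

lemma quad_push {V P : Type*} [Fintype V] [DecidableEq V] [Fintype P] (A : Matrix V V ℝ)
    (f : P → V) (w : P → ℝ) :
    (fun v => ∑ p, if v = f p then w p else 0) ⬝ᵥ
      (A *ᵥ (fun v => ∑ p, if v = f p then w p else 0)) =
    ∑ p, ∑ q, w p * w q * A (f p) (f q) := by
  have h1 : ∀ y : V → ℝ, (fun v => ∑ p, if v = f p then w p else 0) ⬝ᵥ y = ∑ p, w p * y (f p) := by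
    intro y
    simp only [dotProduct, Finset.sum_mul]
    rw [Finset.sum_comm]
    refine Finset.sum_congr rfl fun p _ => ?_
    simp
  rw [h1]
  refine Finset.sum_congr rfl fun p _ => ?_
  rw [Matrix.mulVec, dotProduct_comm, h1, Finset.mul_sum]
  exact Finset.sum_congr rfl fun q _ => by ring

/-- The 3-parameter family of weights on `G_15`. -/
def coef (c : Fin 3 → ℝ) : Fin 8 ⊕ Fin 7 → ℝ := Sum.elim (coefL (c 0) (c 2)) (coefR (c 1) (c 2))

lemma coef_add (c d : Fin 3 → ℝ) (p) : coef (c + d) p = coef c p + coef d p := by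
  rcases p with i | i <;> fin_cases i <;> simp [coef, coefL, coefR] <;> ring

lemma coef_smul (r : ℝ) (c : Fin 3 → ℝ) (p) : coef (r • c) p = r * coef c p := by
  rcases p with i | i <;> fin_cases i <;> simp [coef, coefL, coefR] <;> ring

lemma blow_pos {V : Type*} [Fintype V] [DecidableEq V] (G : SimpleGraph V) {k : ℕ} (hk : 15 ≤ k)
    (φ : V → Fin ((k + 1) / 2) ⊕ Fin (k / 2)) (hφ : Function.Surjective φ)
    (h : IsBlow G (oboudi k) φ) : 3 ≤ Nat.card {i : V // 0 < eigs G i} := by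
  classical
  obtain ⟨sec, hsec⟩ := hφ.hasRightInverse
  have hadj : ∀ p q, G.Adj (sec p) (sec q) ↔ (oboudi k).Adj p q := by
    intro p q
    rw [h, hsec, hsec]
    constructor
    · rintro ⟨h1, h2 | h2⟩
      · exact absurd (congrArg sec h2) h1
      · exact h2
    · intro h2
      exact ⟨fun h3 => h2.ne (hsec.injective h3), Or.inr h2⟩
  let g : Fin 8 ⊕ Fin 7 → Fin ((k + 1) / 2) ⊕ Fin (k / 2) := Sum.elim
    (fun i => Sum.inl ⟨i, by have := i.2; omega⟩)
    (fun j => Sum.inr ⟨j + (k / 2 - 7), by have := j.2; omega⟩)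
  let L : (Fin 3 → ℝ) →ₗ[ℝ] (V → ℝ) :=
    { toFun := fun c v => ∑ p, if v = sec (g p) then coef c p else 0
      map_add' := by
        intro c d; ext v
        simp only [Pi.add_apply, ← Finset.sum_add_distrib]
        refine Finset.sum_congr rfl fun p _ => ?_
        rw [coef_add]; split_ifs <;> simp
      map_smul' := by
        intro r c; ext v
        simp only [Pi.smul_apply, RingHom.id_apply, smul_eq_mul, Finset.mul_sum]
        refine Finset.sum_congr rfl fun p _ => ?_
        rw [coef_smul]; split_ifs <;> simp }
  refine card_pos_ge (adjMat_isHermitian G) L ?_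
  intro c hc
  have hq : L c ⬝ᵥ (adjMat G *ᵥ L c) =
      2 * (c 0 + c 2) ^ 2 + 2 * (c 1 + c 2) ^ 2 + 2 * (c 2) ^ 2 := by
    change (fun v => ∑ p, if v = sec (g p) then coef c p else 0) ⬝ᵥ
      (adjMat G *ᵥ (fun v => ∑ p, if v = sec (g p) then coef c p else 0)) = _
    rw [quad_push _ (fun p => sec (g p)), ← form15]
    have e : ∀ a b m : ℕ, 7 ≤ m → (m ≤ a + (b + (m - 7)) ↔ 7 ≤ a + b) := by
      intro a b m hm; omega
    have hm : 7 ≤ k / 2 := by omega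
    simp only [Fintype.sum_sum_type, adjMat_apply, hadj, g, Sum.elim_inl, Sum.elim_inr,
      oboudi_ll, oboudi_rr, oboudi_lr, oboudi_rl, coef, e _ _ _ hm]
    simp only [ne_eq, Fin.mk.injEq, Nat.add_right_cancel_iff, Fin.val_inj, mul_ite, mul_one,
      mul_zero, ite_not, Finset.sum_add_distrib]
    have : ∑ j : Fin 7, ∑ i : Fin 8, (if 7 ≤ (i : ℕ) + (j : ℕ) then
        coefR (c 1) (c 2) j * coefL (c 0) (c 2) i else 0) =
        ∑ i : Fin 8, ∑ j : Fin 7, (if 7 ≤ (i : ℕ) + (j : ℕ) then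
        coefL (c 0) (c 2) i * coefR (c 1) (c 2) j else 0) := by
      rw [Finset.sum_comm]
      simp only [mul_comm]
    rw [this]
    ring
  rw [hq]
  by_contra hn
  apply hc
  have h0 := sq_nonneg (c 0 + c 2)
  have h1 := sq_nonneg (c 1 + c 2)
  have h2 := sq_nonneg (c 2)
  have e2 : c 2 = 0 := pow_eq_zero_iff (two_ne_zero) |>.mp (by linarith)
  have e1 : c 1 + c 2 = 0 := pow_eq_zero_iff (two_ne_zero) |>.mp (by linarith)
  have e0 : c 0 + c 2 = 0 := pow_eq_zero_iff (two_ne_zero) |>.mp (by linarith)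
  ext i
  fin_cases i
  · simpa [e2] using e0
  · simpa [e2] using e1
  · simpa using e2

lemma toIdx_injective {k : ℕ} : Function.Injective (@toIdx k) := by
  rintro (i | i) (j | j) hij <;> simp only [toIdx, Fin.mk.injEq] at hij
  · exact congrArg _ (Fin.ext hij)
  · have := i.2; omega
  · have := j.2; omega
  · exact congrArg _ (Fin.ext (by omega))

lemma toIdx_surjective {k : ℕ} : Function.Surjective (@toIdx k) := by
  intro i
  by_cases h : (i : ℕ) < (k + 1) / 2
  · exact ⟨Sum.inl ⟨i, h⟩, rfl⟩
  · refine ⟨Sum.inr ⟨i - (k + 1) / 2, by have := i.2; omega⟩, ?_⟩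
    simp only [toIdx]
    exact Fin.ext (by simp; omega)

lemma blow_iso {V : Type*} [Finite V] (G : SimpleGraph V) {k : ℕ}
    (φ : V → Fin ((k + 1) / 2) ⊕ Fin (k / 2)) (hφ : Function.Surjective φ)
    (h : IsBlow G (oboudi k) φ) :
    ∃ nn : Fin k → ℕ, (∀ i, 1 ≤ nn i) ∧ Nonempty (G ≃g bGraph k nn) := by
  classical
  refine ⟨fun i => Nat.card {x // toIdx (φ x) = i}, ?_, ?_⟩
  · intro i
    obtain ⟨u, rfl⟩ := toIdx_surjective i
    obtain ⟨x, rfl⟩ := hφ u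
    have : Nonempty {y // toIdx (φ y) = toIdx (φ x)} := ⟨⟨x, rfl⟩⟩
    exact Nat.card_pos
  · let e1 : V ≃ Σ u, {x // φ x = u} := (Equiv.sigmaFiberEquiv φ).symm
    let e2 : ∀ u, {x // φ x = u} ≃ Fin (Nat.card {x // toIdx (φ x) = toIdx u}) := fun u =>
      (Equiv.subtypeEquivRight fun x => toIdx_injective.eq_iff.symm).trans (Finite.equivFin _)
    let e := e1.trans (Equiv.sigmaCongrRight e2)
    have he : ∀ x, (e x).1 = φ x := fun x => rfl
    refine ⟨⟨e, ?_⟩⟩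
    intro x y
    unfold bGraph lexProd
    rw [SimpleGraph.fromRel_adj, he, he, h, e.injective.ne_iff]
    constructor
    · rintro ⟨h1, (h2 | h2) | (h2 | h2)⟩
      · exact ⟨h1, Or.inl h2⟩
      · exact ⟨h1, Or.inr h2⟩
      · exact ⟨h1, Or.inl h2.symm⟩
      · exact ⟨h1, Or.inr h2.symm⟩
    · rintro ⟨h1, h2⟩
      exact ⟨h1, Or.inl h2⟩

lemma exists_rank (S : Finset ℕ) (i : ℕ) (hi : i < S.card) :
    ∃ s ∈ S, (S.filter (· < s)).card = i := by
  induction S using Finset.induction_on_max generalizing i with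
  | empty => simp at hi
  | insert a S ha ih =>
    have hna : a ∉ S := fun h => lt_irrefl _ (ha a h)
    rw [Finset.card_insert_of_notMem hna] at hi
    rcases Nat.lt_succ_iff_lt_or_eq.mp hi with h | h
    · obtain ⟨s, hs, hc⟩ := ih i h
      refine ⟨s, Finset.mem_insert_of_mem hs, ?_⟩
      rw [Finset.filter_insert, if_neg (not_lt.mpr (ha s hs).le), hc]
    · refine ⟨a, Finset.mem_insert_self _ _, ?_⟩
      rw [Finset.filter_insert, if_neg (lt_irrefl a), Finset.filter_true_of_mem ha, h]

lemma chain_struct {V : Type*} [Fintype V] (G : SimpleGraph V) (Y : Set V) (v : V) (hv : v ∉ Y)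
    (hvY : ∀ y ∈ Y, ¬ G.Adj v y)
    (hch : ∀ x ∉ Y, ∀ x' ∉ Y, G.neighborSet x ∩ Y ⊆ G.neighborSet x' ∩ Y ∨
      G.neighborSet x' ∩ Y ⊆ G.neighborSet x ∩ Y) :
    ∃ (m b : ℕ) (ρ σ : V → ℕ), (b = m ∨ b + 1 = m) ∧ (∀ a ∉ Y, ρ a < m) ∧
      (∀ y ∈ Y, 1 ≤ σ y ∧ σ y ≤ b) ∧ (∀ i < m, ∃ a ∉ Y, ρ a = i) ∧
      (∀ i, 1 ≤ i → i ≤ b → ∃ y ∈ Y, σ y = i) ∧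
      ∀ a ∉ Y, ∀ y ∈ Y, G.Adj a y ↔ σ y ≤ ρ a := by
  classical
  let t : V → ℕ := fun x => (G.neighborSet x ∩ Y).ncard
  have fin : ∀ s : Set V, s.Finite := fun s => s.toFinite
  have mono : ∀ a ∉ Y, ∀ a' ∉ Y, t a ≤ t a' → G.neighborSet a ∩ Y ⊆ G.neighborSet a' ∩ Y := by
    intro a ha a' ha' h
    rcases hch a ha a' ha' with h1 | h1
    · exact h1
    · exact (Set.eq_of_subset_of_ncard_le h1 h (fin _)).ge
  have lt_of : ∀ a ∉ Y, ∀ a' ∉ Y, ∀ y ∈ Y, G.Adj a y → ¬ G.Adj a' y → t a' < t a := by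
    intro a ha a' ha' y hy h1 h2
    by_contra h
    exact h2 (mono a ha a' ha' (not_lt.mp h) ⟨h1, hy⟩).1
  let S : Finset ℕ := (Finset.univ.filter (fun x => x ∉ Y)).image t
  let R : V → Finset ℕ := fun y => (Finset.univ.filter (fun x => x ∉ Y ∧ ¬ G.Adj x y)).image t
  have hS : ∀ a ∉ Y, t a ∈ S := fun a ha => Finset.mem_image_of_mem _ (by simp [ha])
  have hRS : ∀ y, R y ⊆ S := fun y => Finset.image_subset_image fun x hx => by
    simp at hx ⊢; exact hx.1
  let ρ : V → ℕ := fun a => (S.filter (· < t a)).card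
  let σ : V → ℕ := fun y => (R y).card
  have adj : ∀ a ∉ Y, ∀ y ∈ Y, G.Adj a y ↔ σ y ≤ ρ a := by
    intro a ha y hy
    constructor
    · intro h
      apply Finset.card_le_card
      intro s hs
      refine Finset.mem_filter.mpr ⟨hRS y hs, ?_⟩
      obtain ⟨a', ha', rfl⟩ := Finset.mem_image.mp hs
      simp at ha'
      exact lt_of a ha a' ha'.1 y hy h ha'.2
    · intro h
      by_contra hn
      apply absurd h
      rw [not_le]
      apply Finset.card_lt_card
      rw [Finset.ssubset_iff_of_subset]
      · refine ⟨t a, Finset.mem_image_of_mem _ (by simp [ha, hn]), by simp⟩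
      · intro s hs
        obtain ⟨h1, h2⟩ := Finset.mem_filter.mp hs
        obtain ⟨a', ha', rfl⟩ := Finset.mem_image.mp h1
        simp at ha'
        refine Finset.mem_image_of_mem _ ?_
        simp only [Finset.mem_filter, Finset.mem_univ, true_and]
        refine ⟨ha', fun h3 => hn (mono a' ha' a ha h2.le ⟨h3, hy⟩).1⟩
  have hρ : ∀ a ∉ Y, ρ a < S.card := by
    intro a ha
    apply Finset.card_lt_card
    rw [Finset.ssubset_iff_of_subset (Finset.filter_subset _ _)]
    exact ⟨t a, hS a ha, by simp⟩
  have hρs : ∀ i < S.card, ∃ a ∉ Y, ρ a = i := by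
    intro i hi
    obtain ⟨s, hs, hc⟩ := exists_rank S i hi
    obtain ⟨a, ha, rfl⟩ := Finset.mem_image.mp hs
    simp at ha
    exact ⟨a, ha, hc⟩
  have hσ1 : ∀ y ∈ Y, 1 ≤ σ y := by
    intro y hy
    apply Finset.card_pos.mpr
    exact ⟨t v, Finset.mem_image_of_mem _ (by simp [hv, hvY y hy])⟩
  have hσm : ∀ y, σ y ≤ S.card := fun y => Finset.card_le_card (hRS y)
  have hσs : ∀ i, 1 ≤ i → i + 1 ≤ S.card → ∃ y ∈ Y, σ y = i := by
    intro i h1 h2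
    obtain ⟨a, ha, ha'⟩ := hρs i (by omega)
    obtain ⟨c, hc, hc'⟩ := hρs (i - 1) (by omega)
    have : ¬ (G.neighborSet a ∩ Y ⊆ G.neighborSet c ∩ Y) := by
      intro hsub
      have hle : t a ≤ t c := Set.ncard_le_ncard hsub (fin _)
      have : ρ a ≤ ρ c := Finset.card_le_card fun s hs => by
        simp at hs ⊢; exact ⟨hs.1, hs.2.trans_le hle⟩
      omega
    rw [Set.not_subset] at this
    obtain ⟨y, ⟨hy1, hy2⟩, hy3⟩ := this
    refine ⟨y, hy2, ?_⟩
    have e1 := (adj a ha y hy2).mp hy1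
    have e2 := mt (adj c hc y hy2).mpr fun h => hy3 ⟨h, hy2⟩
    omega
  have hm : 0 < S.card := Finset.card_pos.mpr ⟨_, hS v hv⟩
  by_cases hex : ∃ y ∈ Y, σ y = S.card
  · refine ⟨S.card, S.card, ρ, σ, Or.inl rfl, hρ, fun y hy => ⟨hσ1 y hy, hσm y⟩, hρs, ?_, adj⟩
    intro i h1 h2
    rcases Nat.lt_or_eq_of_le h2 with h | h
    · exact hσs i h1 h
    · rw [h]; exact hex
  · refine ⟨S.card, S.card - 1, ρ, σ, Or.inr (by omega), hρ, fun y hy => ⟨hσ1 y hy, ?_⟩, hρs, ?_, adj⟩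
    · have h1 := hσm y
      have h2 : σ y ≠ S.card := fun h => hex ⟨y, hy, h⟩
      omega
    · intro i h1 h2
      exact hσs i h1 (by omega)

lemma exists_blow {V : Type*} [Fintype V] (G : SimpleGraph V) (Y : Set V) (v : V) (hv : v ∉ Y)
    (hvY : ∀ y ∈ Y, ¬ G.Adj v y)
    (hY : Y.Pairwise G.Adj) (hX : Yᶜ.Pairwise G.Adj)
    (hch : ∀ x ∉ Y, ∀ x' ∉ Y, G.neighborSet x ∩ Y ⊆ G.neighborSet x' ∩ Y ∨
      G.neighborSet x' ∩ Y ⊆ G.neighborSet x ∩ Y) :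
    ∃ (k : ℕ) (φ : V → Fin ((k + 1) / 2) ⊕ Fin (k / 2)), Function.Surjective φ ∧
      IsBlow G (oboudi k) φ := by
  classical
  obtain ⟨m, b, ρ, σ, hmb, hρ, hσ, hρs, hσs, adj⟩ := chain_struct G Y v hv hvY hch
  have hm : ((m + b) + 1) / 2 = m := by have := hρ v hv; omega
  have hb : (m + b) / 2 = b := by have := hρ v hv; omega
  let φ : V → Fin (((m + b) + 1) / 2) ⊕ Fin ((m + b) / 2) := fun x =>
    if h : x ∈ Y then Sum.inr ⟨b - σ x, by have := hσ x h; omega⟩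
    else Sum.inl ⟨ρ x, by have := hρ x h; omega⟩
  have φY : ∀ x (h : x ∈ Y), φ x = Sum.inr ⟨b - σ x, by have := hσ x h; omega⟩ :=
    fun x h => dif_pos h
  have φX : ∀ x (h : x ∉ Y), φ x = Sum.inl ⟨ρ x, by have := hρ x h; omega⟩ :=
    fun x h => dif_neg h
  refine ⟨m + b, φ, ?_, ?_⟩
  · rintro (⟨i, hi⟩ | ⟨j, hj⟩)
    · obtain ⟨a, ha, rfl⟩ := hρs i (by omega)
      exact ⟨a, φX a ha⟩
    · obtain ⟨y, hy, hyj⟩ := hσs (b - j) (by omega) (by omega)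
      refine ⟨y, ?_⟩
      rw [φY y hy]
      congr 2
      omega
  · have cross : ∀ a ∉ Y, ∀ y ∈ Y, G.Adj a y ↔ (oboudi (m + b)).Adj (φ a) (φ y) := by
      intro a ha y hy
      rw [φX a ha, φY y hy, oboudi_lr, adj a ha y hy]
      have := hσ y hy
      simp only
      omega
    intro x y
    by_cases hx : x ∈ Y <;> by_cases hy : y ∈ Y
    · constructor
      · intro h
        refine ⟨h.ne, ?_⟩
        rw [φY x hx, φY y hy, oboudi_rr, Sum.inr.injEq]
        exact em _
      · rintro ⟨h, -⟩
        exact hY hx hy h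
    · rw [G.adj_comm, cross y hy x hx, SimpleGraph.adj_comm]
      have : x ≠ y := fun h => hy (h ▸ hx)
      have h2 : φ x ≠ φ y := by rw [φY x hx, φX y hy]; simp
      simp [this, h2]
    · rw [cross x hx y hy]
      have : x ≠ y := fun h => hx (h ▸ hy)
      have h2 : φ x ≠ φ y := by rw [φX x hx, φY y hy]; simp
      simp [this, h2]
    · constructor
      · intro h
        refine ⟨h.ne, ?_⟩
        rw [φX x hx, φX y hy, oboudi_ll, Sum.inl.injEq]
        exact em _
      · rintro ⟨h, -⟩
        exact hX hx hy h

theorem reduced_Xcomplete_is_bGraph {n s : ℕ} (hs : 2 ≤ s) (hsn : s ≤ n - 3)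
    (G : SimpleGraph (Fin n)) (hconn : G.Connected) (hG : memClass s G)
    (v : Fin n) (hv : IsMinDegVertex G v)
    (hXc : IsXComplete G v) (hred : IsReduced G v) :
    ∃ (k : ℕ) (nn : Fin k → ℕ), 4 ≤ k ∧ k ≤ 14 ∧ (∀ i, 1 ≤ nn i) ∧
      Nonempty (G ≃g bGraph k nn) := by
  obtain ⟨-, hY, hX⟩ := hXc
  have hvY : ∀ y ∈ Yset G v, ¬ G.Adj v y := fun y hy h => hy (Or.inl h)
  have hv0 : v ∉ Yset G v := fun h => h (Or.inr rfl)
  have hcl : ∀ x ∉ Yset G v, x = v ∨ G.Adj v x := by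
    intro x hx
    rcases not_not.mp hx with h | h
    · exact Or.inr h
    · exact Or.inl h
  have hemp : G.neighborSet v ∩ Yset G v = ∅ := by
    ext y
    simp only [Set.mem_inter_iff, SimpleGraph.mem_neighborSet, Set.mem_empty_iff_false, iff_false]
    exact fun h => hvY y h.2 h.1
  obtain ⟨k, φ, hsur, hblow⟩ := exists_blow G (Yset G v) v hv0 hvY hY
    (by
      intro x hx y hy hne
      rcases hcl x hx with rfl | h1
      · rcases hcl y hy with rfl | h2
        · exact absurd rfl hne
        · exact h2
      · rcases hcl y hy with rfl | h2
        · exact h1.symm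
        · exact hX h1 h2 hne)
    (by
      intro x hx y hy
      rcases hcl x hx with rfl | h1
      · left; rw [hemp]; exact Set.empty_subset _
      · rcases hcl y hy with rfl | h2
        · right; rw [hemp]; exact Set.empty_subset _
        · exact hred x h1 y h2)
  obtain ⟨nn, hnn, hiso⟩ := blow_iso G φ hsur hblow
  obtain ⟨hp, hz⟩ := hG
  refine ⟨k, nn, ?_, ?_, hnn, hiso⟩
  · let i1 := Fintype.ofFinite (Fin n)
    let i2 := Classical.decEq (Fin n)
    have h1 := @blow_card_le _ _ i1 i2 _ G (oboudi k) φ hblow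
    have h2 : Nat.card {i // 0 ≤ @eigs _ i1 i2 G i} =
        Nat.card {i // 0 < @eigs _ i1 i2 G i} + Nat.card {i // @eigs _ i1 i2 G i = 0} := by
      classical
      rw [← Nat.card_sum]
      refine Nat.card_congr (Equiv.trans (Equiv.subtypeEquivRight fun i => ?_)
        (subtypeOrEquiv _ _ ?_))
      · rw [le_iff_lt_or_eq, eq_comm (a := (0 : ℝ))]
      · rw [Pi.disjoint_iff]
        intro i
        rw [Prop.disjoint_iff]
        rintro ⟨h, h'⟩
        exact h.ne h'.symm
    have h3 : Nat.card {i // 0 < @eigs _ i1 i2 G i} = 2 := hp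
    have h4 : Nat.card {i // @eigs _ i1 i2 G i = 0} = s := hz
    simp only [Fintype.card_sum, Fintype.card_fin] at h1
    omega
  · by_contra hk
    have h1 := @blow_pos _ (Fintype.ofFinite (Fin n)) (Classical.decEq (Fin n)) G k
      (by omega) φ hsur hblow
    have h3 : 3 ≤ posCount G := h1
    omega

end TwoPosEig
end

section
/- For every integer k with 4 ≤ k ≤ 14, there is no graph G = B_k(n_1,…,n_k) of order 15 (n_1+⋯+n_k = 15, all n_i ≥ 1) whose third-largest adjacency eigenvalue equals 0; that is, 𝓑_k^0(15) ∪ 𝓑_k^{00}(15) = ∅. -/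
open Matrix BigOperators

namespace TwoPosEig

variable {V : Type*}

/-! ### Computation -/

/-- Scaled integer transfer recursion. -/
def zrun (D i : ℤ) : List ℕ → Bool → ℤ → ℤ → ℤ × ℤ
  | [], _, p, q => (p, q)
  | c :: l, b, p, q =>
      zrun D i l (!b) q (D * D * p + (if b then i * (c : ℤ) * q else -(i * (c : ℤ) * q)))

/-- Real transfer recursion. -/
noncomputable def rrun (r : ℝ) : List ℕ → Bool → ℝ → ℝ → ℝ × ℝ
  | [], _, p, q => (p, q)
  | c :: l, b, p, q =>
      rrun r l (!b) q (p + (if b then r * (c : ℝ) * q else -(r * (c : ℝ) * q)))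

/-- The closing determinant. -/
def closeDet {R : Type*} [CommRing R] (ev : Bool) (A B : R) (x y : R × R) : R :=
  if ev then x.1 * (y.2 - B) - (x.2 - B) * (y.1 - A)
  else (x.1 - A) * (y.2 - B) - x.2 * (y.1 - A)

/-- Integer characteristic function. -/
def fz (D i : ℤ) (l : List ℕ) : ℤ :=
  closeDet (l.length % 2 == 0) (D ^ l.length) (D * D ^ l.length)
    (zrun D i l false 1 D) (zrun D i l false 1 0)

/-- Real characteristic function. -/
noncomputable def fr (r : ℝ) (l : List ℕ) : ℝ :=
  closeDet (l.length % 2 == 0) 1 1 (rrun r l false 1 1) (rrun r l false 1 0)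

/-- Either nonsingular, or three sign changes. -/
def good (l : List ℕ) : Bool :=
  (fz 1 1 l != 0) ||
    (decide (fz 34 0 l * fz 34 4 l < 0) && decide (fz 34 4 l * fz 34 12 l < 0) &&
      decide (fz 34 12 l * fz 34 33 l < 0))

/-- Check all compositions of `s` into `k` positive parts. -/
def allComps : ℕ → ℕ → (List ℕ → Bool) → Bool
  | 0, s, P => (s != 0) || P []
  | k + 1, s, P => (List.range (s - k)).all fun a =>
      allComps k (s - (a + 1)) fun l => P ((a + 1) :: l)

lemma allComps_spec : ∀ (k s : ℕ) (P : List ℕ → Bool), allComps k s P = true →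
    ∀ l : List ℕ, l.length = k → (∀ x ∈ l, 1 ≤ x) → l.sum = s → P l = true := by
  intro k
  induction k with
  | zero =>
    intro s P h l hl _ hs
    have : l = [] := List.length_eq_zero_iff.mp hl
    subst this
    simp at hs
    subst hs
    simpa [allComps] using h
  | succ k ih =>
    intro s P h l hl hp hs
    cases l with
    | nil => simp at hl
    | cons x l =>
      simp only [List.length_cons, Nat.add_right_cancel_iff] at hl
      have hx : 1 ≤ x := hp x (by simp)
      have hp' : ∀ y ∈ l, 1 ≤ y := fun y hy => hp y (by simp [hy])
      have hlen : l.length ≤ l.sum := by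
        clear ih h hl hs hp
        induction l with
        | nil => simp
        | cons z l ih2 =>
          have h1 := hp' z (by simp)
          have h2 := ih2 (fun y hy => hp' y (by simp [hy]))
          simp; omega
      simp only [List.sum_cons] at hs
      simp only [allComps, List.all_eq_true, List.mem_range] at h
      have h3 := h (x - 1) (by omega)
      have hx1 : x - 1 + 1 = x := by omega
      rw [hx1] at h3
      exact ih _ _ h3 l hl hp' (by omega)

lemma good4 : allComps 4 15 good = true := by decide +kernel
lemma good5 : allComps 5 15 good = true := by decide +kernel
lemma good6 : allComps 6 15 good = true := by decide +kernel
lemma good7 : allComps 7 15 good = true := by decide +kernel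
lemma good8 : allComps 8 15 good = true := by decide +kernel
lemma good9 : allComps 9 15 good = true := by decide +kernel
lemma good10 : allComps 10 15 good = true := by decide +kernel
lemma good11 : allComps 11 15 good = true := by decide +kernel
lemma good12 : allComps 12 15 good = true := by decide +kernel
lemma good13 : allComps 13 15 good = true := by decide +kernel
lemma good14 : allComps 14 15 good = true := by decide +kernel

lemma good_of (l : List ℕ) (h4 : 4 ≤ l.length) (h14 : l.length ≤ 14)
    (hp : ∀ x ∈ l, 1 ≤ x) (hs : l.sum = 15) : good l = true := by
  obtain ⟨k, hk⟩ : ∃ k, l.length = k := ⟨_, rfl⟩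
  rw [hk] at h4 h14
  have : allComps k 15 good = true := by
    interval_cases k
    exacts [good4, good5, good6, good7, good8, good9, good10, good11, good12, good13, good14]
  exact allComps_spec k 15 good this l hk hp hs

/-! ### Relating the integer and the real recursion -/

lemma zrun_rrun (D i : ℤ) (hD : (D : ℝ) ≠ 0) : ∀ (l : List ℕ) (b : Bool) (P Q : ℤ) (α p q : ℝ),
    (P : ℝ) = α * p → (Q : ℝ) = α * D * q →
    ((zrun D i l b P Q).1 : ℝ) = α * D ^ l.length * (rrun ((i : ℝ) / D) l b p q).1 ∧
    ((zrun D i l b P Q).2 : ℝ) = α * D ^ l.length * D * (rrun ((i : ℝ) / D) l b p q).2 := by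
  intro l
  induction l with
  | nil => intro b P Q α p q hP hQ; simp [zrun, rrun, hP, hQ]
  | cons c l ih =>
    intro b P Q α p q hP hQ
    simp only [zrun, rrun]
    have := ih (!b) Q (D * D * P + (if b then i * (c : ℤ) * Q else -(i * (c : ℤ) * Q)))
      (α * D) q (p + (if b then (i : ℝ) / D * (c : ℝ) * q else -((i : ℝ) / D * (c : ℝ) * q)))
      hQ (by
        cases b
        · simp only [Bool.false_eq_true, if_false]; push_cast; rw [hP, hQ]; field_simp
        · simp only [if_true]; push_cast; rw [hP, hQ]; field_simp)
    refine ⟨this.1.trans ?_, this.2.trans ?_⟩ <;> simp only [List.length_cons, pow_succ] <;> ring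

lemma fz_fr (D i : ℤ) (hD : (D : ℝ) ≠ 0) (l : List ℕ) :
    (fz D i l : ℝ) = (D * (D ^ l.length) ^ 2 : ℝ) * fr ((i : ℝ) / D) l := by
  obtain ⟨h1, h2⟩ := zrun_rrun D i hD l false 1 D 1 1 1 (by simp) (by simp)
  obtain ⟨h3, h4⟩ := zrun_rrun D i hD l false 1 0 1 1 0 (by simp) (by simp)
  unfold fz fr closeDet
  split_ifs
  · push_cast; rw [h1, h2, h3, h4]; ring
  · push_cast; rw [h1, h2, h3, h4]; ring

lemma rrun_cont : ∀ (l : List ℕ) (b : Bool) (p q : ℝ → ℝ), Continuous p → Continuous q →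
    Continuous (fun r => rrun r l b (p r) (q r)) := by
  intro l
  induction l with
  | nil => intro b p q hp hq; simp only [rrun]; fun_prop
  | cons c l ih =>
    intro b p q hp hq
    simp only [rrun]
    apply ih _ _ _ hq
    cases b
    · simp only [Bool.false_eq_true, if_false]; fun_prop
    · simp only [if_true]; fun_prop

lemma fr_cont (l : List ℕ) : Continuous (fun r => fr r l) := by
  have h1 := rrun_cont l false (fun _ => 1) (fun _ => 1) (by fun_prop) (by fun_prop)
  have h2 := rrun_cont l false (fun _ => 1) (fun _ => 0) (by fun_prop) (by fun_prop)
  unfold fr closeDet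
  split_ifs
  · fun_prop
  · fun_prop

lemma exists_root (l : List ℕ) (a b : ℝ) (hab : a < b) (h : fr a l * fr b l < 0) :
    ∃ r, a < r ∧ r < b ∧ fr r l = 0 := by
  have hc := (fr_cont l).continuousOn (s := Set.Icc a b)
  rcases mul_neg_iff.mp h with ⟨h1, h2⟩ | ⟨h1, h2⟩
  · obtain ⟨r, hr, h0⟩ := intermediate_value_Ioo' hab.le hc ⟨h2, h1⟩
    exact ⟨r, hr.1, hr.2, h0⟩
  · obtain ⟨r, hr, h0⟩ := intermediate_value_Ioo hab.le hc ⟨h1, h2⟩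
    exact ⟨r, hr.1, hr.2, h0⟩

lemma sign_fr (l : List ℕ) (i j : ℤ) (h : fz 34 i l * fz 34 j l < 0) :
    fr ((i : ℝ) / 34) l * fr ((j : ℝ) / 34) l < 0 := by
  have h1 := fz_fr 34 i (by norm_num) l
  have h2 := fz_fr 34 j (by norm_num) l
  have h' : (fz 34 i l : ℝ) * fz 34 j l < 0 := by exact_mod_cast h
  rw [h1, h2] at h'
  push_cast at h'
  by_contra hcon
  push Not at hcon
  have h3 : (0 : ℝ) < 34 * (34 ^ l.length) ^ 2 := by positivity
  have h4 := mul_nonneg (mul_pos h3 h3).le hcon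
  nlinarith

lemma good_cases (l : List ℕ) (h : good l = true) :
    fr 1 l ≠ 0 ∨ ∃ r₁ r₂ r₃ : ℝ, 0 < r₁ ∧ r₁ < r₂ ∧ r₂ < r₃ ∧ r₃ < 1 ∧
      fr r₁ l = 0 ∧ fr r₂ l = 0 ∧ fr r₃ l = 0 := by
  simp only [good, Bool.or_eq_true, bne_iff_ne, Bool.and_eq_true, decide_eq_true_eq] at h
  rcases h with h | ⟨⟨h1, h2⟩, h3⟩
  · left
    have := fz_fr 1 1 (by norm_num) l
    simp only [Int.cast_one, one_pow, mul_one, one_mul, div_one] at this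
    rw [← this]
    exact_mod_cast h
  · right
    obtain ⟨r₁, a1, b1, c1⟩ := exists_root l _ _ (by norm_num) (sign_fr l _ _ h1)
    obtain ⟨r₂, a2, b2, c2⟩ := exists_root l _ _ (by norm_num) (sign_fr l _ _ h2)
    obtain ⟨r₃, a3, b3, c3⟩ := exists_root l _ _ (by norm_num) (sign_fr l _ _ h3)
    norm_num at a1 b1 a2 b2 a3 b3
    exact ⟨r₁, r₂, r₃, by linarith, by linarith, by linarith, by linarith, c1, c2, c3⟩

/-! ### The infinite staircase relation and its row sums -/

/-- Adjacency-or-equality relation of the blocks in path order. -/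
def stair (s t : ℕ) : Prop :=
  s % 2 = t % 2 ∨ (s % 2 = 0 ∧ t < s) ∨ (s % 2 = 1 ∧ s < t)

instance (s t : ℕ) : Decidable (stair s t) := by unfold stair; infer_instance

/-- Row sums. -/
noncomputable def rowS (k : ℕ) (g : ℕ → ℝ) (t : ℕ) : ℝ :=
  ∑ s ∈ Finset.range k, if stair t s then g s else 0

lemma rowS_zero (k : ℕ) (g : ℕ → ℝ) :
    rowS k g 0 = ∑ s ∈ Finset.range k, if s % 2 = 0 then g s else 0 := by
  unfold rowS
  apply Finset.sum_congr rfl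
  intro s _
  have : stair 0 s ↔ s % 2 = 0 := by unfold stair; omega
  simp only [this]

lemma rowS_odd_large (k : ℕ) (g : ℕ → ℝ) (t : ℕ) (ht : t % 2 = 1) (hk : k ≤ t) :
    rowS k g t = ∑ s ∈ Finset.range k, if s % 2 = 1 then g s else 0 := by
  unfold rowS
  apply Finset.sum_congr rfl
  intro s hs
  have hs' := Finset.mem_range.mp hs
  have : stair t s ↔ s % 2 = 1 := by unfold stair; omega
  simp only [this]

lemma rowS_even_large (k : ℕ) (g : ℕ → ℝ) (t : ℕ) (ht : t % 2 = 0) (hk : k ≤ t) :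
    rowS k g t = (∑ s ∈ Finset.range k, if s % 2 = 0 then g s else 0) +
      ∑ s ∈ Finset.range k, if s % 2 = 1 then g s else 0 := by
  unfold rowS
  rw [← Finset.sum_add_distrib]
  apply Finset.sum_congr rfl
  intro s hs
  have hs' := Finset.mem_range.mp hs
  have : stair t s := by unfold stair; omega
  rcases Nat.mod_two_eq_zero_or_one s with h | h <;> simp [this, h]

lemma rowS_one (k : ℕ) (hk : 0 < k) (g : ℕ → ℝ) :
    rowS k g 1 = (∑ s ∈ Finset.range k, if s % 2 = 0 then g s else 0) +
      (∑ s ∈ Finset.range k, if s % 2 = 1 then g s else 0) - g 0 := by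
  have h0 : g 0 = ∑ s ∈ Finset.range k, if s = 0 then g s else 0 := by
    rw [Finset.sum_ite_eq' (Finset.range k) 0 g]; simp [hk]
  rw [h0]
  unfold rowS
  rw [← Finset.sum_add_distrib, ← Finset.sum_sub_distrib]
  apply Finset.sum_congr rfl
  intro s hs
  by_cases hz : s = 0
  · subst hz; simp [stair]
  · have : stair 1 s := by unfold stair; omega
    rcases Nat.mod_two_eq_zero_or_one s with h | h <;> simp [this, h, hz]

lemma rowS_step (k : ℕ) (g : ℕ → ℝ) (hg : ∀ s, k ≤ s → g s = 0) (t : ℕ) :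
    rowS k g (t + 2) = rowS k g t + (if t % 2 = 0 then g (t + 1) else - g (t + 1)) := by
  have h0 : g (t + 1) = ∑ s ∈ Finset.range k, if s = t + 1 then g s else 0 := by
    rw [Finset.sum_ite_eq' (Finset.range k) (t + 1) g]
    by_cases h : t + 1 < k
    · simp [h]
    · simp [h, hg (t + 1) (by omega)]
  rcases Nat.mod_two_eq_zero_or_one t with h | h
  · simp only [h, if_true]
    rw [h0]
    unfold rowS
    rw [← Finset.sum_add_distrib]
    apply Finset.sum_congr rfl
    intro s hs
    by_cases hz : s = t + 1
    · have h1 : stair (t + 2) s := by unfold stair; omega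
      have h2 : ¬ stair t s := by unfold stair; omega
      simp [hz] at h1 h2 ⊢; simp [h1, h2]
    · have h1 : stair (t + 2) s ↔ stair t s := by unfold stair; omega
      simp [h1, hz]
  · simp only [h, one_ne_zero, if_false]
    rw [h0]
    unfold rowS
    rw [← sub_eq_add_neg, ← Finset.sum_sub_distrib]
    apply Finset.sum_congr rfl
    intro s hs
    by_cases hz : s = t + 1
    · have h1 : ¬ stair (t + 2) s := by unfold stair; omega
      have h2 : stair t s := by unfold stair; omega
      simp [hz] at h1 h2 ⊢; simp [h1, h2]
    · have h1 : stair (t + 2) s ↔ stair t s := by unfold stair; omega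
      simp [h1, hz]

/-! ### The transfer sequence -/

/-- The transfer sequence `(Y_{t-1}, Y_t)`. -/
noncomputable def st (r : ℝ) (c : ℕ → ℕ) (a o : ℝ) : ℕ → ℝ × ℝ
  | 0 => (a + o, a)
  | t + 1 => ((st r c a o t).2, (st r c a o t).1 +
      (if t % 2 = 1 then r * c t * (st r c a o t).2 else -(r * c t * (st r c a o t).2)))

lemma st_lin (r : ℝ) (c : ℕ → ℕ) (a o : ℝ) (t : ℕ) :
    (st r c a o t).1 = a * (st r c 1 0 t).1 + o * (st r c 0 1 t).1 ∧
    (st r c a o t).2 = a * (st r c 1 0 t).2 + o * (st r c 0 1 t).2 := by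
  induction t with
  | zero => simp [st]
  | succ t ih =>
    simp only [st]
    rw [ih.1, ih.2]
    refine ⟨rfl, ?_⟩
    split_ifs <;> ring

lemma rrun_st (r : ℝ) (c : ℕ → ℕ) (a o : ℝ) : ∀ (l : List ℕ) (t : ℕ),
    (∀ i (h : i < l.length), c (t + i) = l[i]) →
    rrun r l (decide (t % 2 = 1)) (st r c a o t).1 (st r c a o t).2 = st r c a o (t + l.length) := by
  intro l
  induction l with
  | nil => intro t _; simp [rrun]
  | cons x l ih =>
    intro t h
    have h0 : c t = x := h 0 (by simp)
    have h1 := ih (t + 1) (fun i hi => by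
      have := h (i + 1) (by simpa using hi)
      rw [show t + 1 + i = t + (i + 1) by ring, this]; simp)
    rw [List.length_cons, show t + (l.length + 1) = t + 1 + l.length by ring, ← h1]
    simp only [rrun, st, h0]
    have : (!decide (t % 2 = 1)) = decide ((t + 1) % 2 = 1) := by
      rcases Nat.mod_two_eq_zero_or_one t with h | h
      · have : (t + 1) % 2 = 1 := by omega
        simp [h, this]
      · have : (t + 1) % 2 = 0 := by omega
        simp [h, this]
    rw [this]
    simp only [decide_eq_true_eq]

/-- The closing condition. -/
def closing (r : ℝ) (c : ℕ → ℕ) (k : ℕ) (a o : ℝ) : Prop :=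
  if k % 2 = 0 then (st r c a o k).1 = o ∧ (st r c a o k).2 = a + o
  else (st r c a o k).1 = a + o ∧ (st r c a o k).2 = o

lemma exists_null (α β γ δ : ℝ) (h : α * δ - γ * β = 0) :
    ∃ a o : ℝ, (a ≠ 0 ∨ o ≠ 0) ∧ α * a + β * o = 0 ∧ γ * a + δ * o = 0 := by
  by_cases h1 : α = 0 ∧ β = 0
  · by_cases h2 : γ = 0 ∧ δ = 0
    · exact ⟨1, 0, by simp, by simp [h1.1], by simp [h2.1]⟩
    · refine ⟨-δ, γ, ?_, by simp [h1.1, h1.2], by ring⟩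
      by_contra hc; push Not at hc; exact h2 ⟨hc.2, by simpa using hc.1⟩
  · refine ⟨-β, α, ?_, by ring, by linarith⟩
    by_contra hc; push Not at hc; exact h1 ⟨hc.2, by simpa using hc.1⟩

lemma unique_null (α β γ δ : ℝ) (h : α * δ - γ * β ≠ 0) (a o : ℝ)
    (h1 : α * a + β * o = 0) (h2 : γ * a + δ * o = 0) : a = 0 ∧ o = 0 := by
  constructor
  · have : (α * δ - γ * β) * a = 0 := by linear_combination δ * h1 - β * h2
    exact (mul_eq_zero.mp this).resolve_left h
  · have : (α * δ - γ * β) * o = 0 := by linear_combination α * h2 - γ * h1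
    exact (mul_eq_zero.mp this).resolve_left h

lemma fr_st (r : ℝ) (c : ℕ → ℕ) (l : List ℕ) (hc : ∀ i (h : i < l.length), c i = l[i]) :
    fr r l = closeDet (l.length % 2 == 0) 1 1 (st r c 1 0 l.length) (st r c 0 1 l.length) := by
  have h1 := rrun_st r c 1 0 l 0 (by simpa using hc)
  have h2 := rrun_st r c 0 1 l 0 (by simpa using hc)
  simp [st] at h1 h2
  unfold fr
  rw [h1, h2]

lemma closing_exists (r : ℝ) (c : ℕ → ℕ) (l : List ℕ) (hc : ∀ i (h : i < l.length), c i = l[i])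
    (h : fr r l = 0) : ∃ a o : ℝ, (a ≠ 0 ∨ o ≠ 0) ∧ closing r c l.length a o := by
  rw [fr_st r c l hc] at h
  unfold closeDet at h
  unfold closing
  by_cases hk : l.length % 2 = 0
  · simp only [hk, beq_self_eq_true, if_true] at h
    obtain ⟨a, o, h0, h1, h2⟩ := exists_null (st r c 1 0 l.length).1 ((st r c 0 1 l.length).1 - 1)
      ((st r c 1 0 l.length).2 - 1) ((st r c 0 1 l.length).2 - 1) h
    refine ⟨a, o, h0, ?_⟩
    rw [if_pos hk, (st_lin r c a o _).1, (st_lin r c a o _).2]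
    constructor <;> linarith
  · have hk' : (l.length % 2 == 0) = false := by simpa using hk
    simp only [hk', Bool.false_eq_true, if_false] at h
    obtain ⟨a, o, h0, h1, h2⟩ := exists_null ((st r c 1 0 l.length).1 - 1)
      ((st r c 0 1 l.length).1 - 1)
      (st r c 1 0 l.length).2 ((st r c 0 1 l.length).2 - 1) h
    refine ⟨a, o, h0, ?_⟩
    rw [if_neg hk, (st_lin r c a o _).1, (st_lin r c a o _).2]
    constructor <;> linarith

lemma closing_unique (r : ℝ) (c : ℕ → ℕ) (l : List ℕ) (hc : ∀ i (h : i < l.length), c i = l[i])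
    (h : fr r l ≠ 0) (a o : ℝ) (hcl : closing r c l.length a o) : a = 0 ∧ o = 0 := by
  rw [fr_st r c l hc] at h
  unfold closeDet at h
  unfold closing at hcl
  rw [(st_lin r c a o _).1, (st_lin r c a o _).2] at hcl
  by_cases hk : l.length % 2 = 0
  · simp only [hk, beq_self_eq_true, if_true] at h hcl
    exact unique_null _ _ _ _ h a o (by linarith) (by linarith)
  · have hk' : (l.length % 2 == 0) = false := by simpa using hk
    simp only [hk', Bool.false_eq_true, if_false, if_neg hk] at h hcl
    exact unique_null _ _ _ _ h a o (by linarith) (by linarith)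

/-- A solution of `Y = r C (c Y)` satisfies the closing condition. -/
lemma sol_closing (r : ℝ) (c : ℕ → ℕ) (k : ℕ) (hk : 0 < k) (hc : ∀ t, k ≤ t → c t = 0)
    (Y : ℕ → ℝ) (hY : ∀ t, Y t = r * rowS k (fun s => c s * Y s) t) :
    ∃ o, closing r c k (Y 0) o ∧ ∀ t, (st r c (Y 0) o t).2 = Y t := by
  set g : ℕ → ℝ := fun s => c s * Y s with hgdef
  have hg : ∀ s, k ≤ s → g s = 0 := fun s hs => by simp [hgdef, hc s hs]
  set E := ∑ s ∈ Finset.range k, if s % 2 = 0 then g s else 0 with hE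
  set O := ∑ s ∈ Finset.range k, if s % 2 = 1 then g s else 0 with hO
  have h0 : Y 0 = r * E := by rw [hY 0, rowS_zero]
  have hst : ∀ t, st r c (Y 0) (r * O) (t + 1) = (Y t, Y (t + 1)) := by
    intro t
    induction t with
    | zero =>
      simp only [st, zero_add]
      rw [hY 1, rowS_one k hk g, ← hE, ← hO]
      simp only [Nat.zero_mod, zero_ne_one, if_false, Prod.mk.injEq, true_and]
      simp only [hgdef]
      rw [h0]; ring
    | succ t ih =>
      rw [st, ih]
      simp only [Prod.mk.injEq, true_and]
      rw [hY (t + 1 + 1), rowS_step k g hg t, mul_add, ← hY t]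
      simp only [hgdef]
      rcases Nat.mod_two_eq_zero_or_one t with h | h
      · have : (t + 1) % 2 = 1 := by omega
        simp only [h, this, if_true]; ring
      · have : (t + 1) % 2 = 0 := by omega
        simp only [h, this, zero_ne_one, one_ne_zero, if_false]; ring
  refine ⟨r * O, ?_, ?_⟩
  · obtain ⟨k', rfl⟩ : ∃ k', k = k' + 1 := ⟨k - 1, by omega⟩
    have hprev : Y (k' + 2) = Y k' := by
      rw [hY (k' + 2), rowS_step (k' + 1) g hg k', hg (k' + 1) le_rfl, hY k']; simp
    unfold closing
    rw [hst k']
    split_ifs with hp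
    · refine ⟨?_, ?_⟩
      · show Y k' = _
        rw [← hprev, hY, rowS_odd_large _ _ _ (by omega) (by omega)]
      · show Y (k' + 1) = _
        rw [hY, rowS_even_large _ _ _ (by omega) (by omega), h0, mul_add]
    · refine ⟨?_, ?_⟩
      · show Y k' = _
        rw [← hprev, hY, rowS_even_large _ _ _ (by omega) (by omega), h0, mul_add]
      · show Y (k' + 1) = _
        rw [hY, rowS_odd_large _ _ _ (by omega) (by omega)]
  · intro t
    cases t with
    | zero => simp [st]
    | succ t => rw [hst t]

/-- Conversely, the closing condition produces a solution. -/
lemma closing_sol (r : ℝ) (c : ℕ → ℕ) (k : ℕ) (hk : 0 < k) (hc : ∀ t, k ≤ t → c t = 0)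
    (a o : ℝ) (hcl : closing r c k a o) (hao : a ≠ 0 ∨ o ≠ 0) :
    ∃ Y : ℕ → ℝ, (∀ t, Y t = r * rowS k (fun s => c s * Y s) t) ∧ ∃ t < k, Y t ≠ 0 := by
  set Y : ℕ → ℝ := fun t => (st r c a o t).2 with hYdef
  set g : ℕ → ℝ := fun s => c s * Y s with hgdef
  have hg : ∀ s, k ≤ s → g s = 0 := fun s hs => by simp [hgdef, hc s hs]
  set E := ∑ s ∈ Finset.range k, if s % 2 = 0 then g s else 0 with hE
  set O := ∑ s ∈ Finset.range k, if s % 2 = 1 then g s else 0 with hO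
  have hY0 : Y 0 = a := by simp [hYdef, st]
  have hY1 : Y 1 = a + o - r * g 0 := by
    simp [hYdef, hgdef, st]; ring
  have hYs : ∀ t, Y (t + 2) = Y t + r * (if t % 2 = 0 then g (t + 1) else - g (t + 1)) := by
    intro t
    have h1 : (st r c a o (t + 1)).1 = Y t := by simp only [st, hYdef]
    have h2 : (st r c a o (t + 1)).2 = Y (t + 1) := rfl
    have h3 : Y (t + 2) = (st r c a o (t + 1 + 1)).2 := rfl
    rw [h3, st]
    simp only [h1, h2, hgdef]
    rcases Nat.mod_two_eq_zero_or_one t with h | h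
    · have : (t + 1) % 2 = 1 := by omega
      simp only [h, this, if_true]; ring
    · have : (t + 1) % 2 = 0 := by omega
      simp only [h, this, zero_ne_one, one_ne_zero, if_false]; ring
  have hd : ∀ t, Y (t + 2) - r * rowS k g (t + 2) = Y t - r * rowS k g t := by
    intro t; rw [hYs, rowS_step k g hg]; ring
  have hde : ∀ m, Y (2 * m) - r * rowS k g (2 * m) = Y 0 - r * rowS k g 0 := by
    intro m
    induction m with
    | zero => rfl
    | succ m ih => rw [show 2 * (m + 1) = 2 * m + 2 by ring, hd, ih]
  have hdo : ∀ m, Y (2 * m + 1) - r * rowS k g (2 * m + 1) = Y 1 - r * rowS k g 1 := by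
    intro m
    induction m with
    | zero => rfl
    | succ m ih => rw [show 2 * (m + 1) + 1 = 2 * m + 1 + 2 by ring, hd, ih]
  have hend : ∃ m, k ≤ 2 * m ∧ Y (2 * m) = a + o ∧ Y (2 * m + 1) = o := by
    have hYk : Y (k + 1) = (st r c a o k).1 := by
      simp only [hYdef, st, hc k le_rfl]; simp
    unfold closing at hcl
    split_ifs at hcl with hp
    · refine ⟨k / 2, by omega, ?_, ?_⟩
      · rw [show 2 * (k / 2) = k by omega]; exact hcl.2
      · rw [show 2 * (k / 2) + 1 = k + 1 by omega, hYk]; exact hcl.1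
    · refine ⟨(k + 1) / 2, by omega, ?_, ?_⟩
      · rw [show 2 * ((k + 1) / 2) = k + 1 by omega, hYk]; exact hcl.1
      · rw [show 2 * ((k + 1) / 2) + 1 = k + 2 by omega, hYs, hg (k + 1) (by omega)]
        simpa using hcl.2
  obtain ⟨m, hm, he1, he2⟩ := hend
  have e1 := hde m
  have e2 := hdo m
  rw [he1, rowS_even_large k g _ (by omega) hm, rowS_zero, hY0, ← hE, ← hO] at e1
  rw [he2, rowS_odd_large k g _ (by omega) (by omega), rowS_one k hk g, hY1, ← hE, ← hO] at e2
  have hα : a - r * E = 0 := by linarith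
  have hβ : o - r * O = 0 := by linarith
  have hsol : ∀ t, Y t = r * rowS k g t := by
    intro t
    rcases Nat.even_or_odd' t with ⟨n, rfl | rfl⟩
    · have := hde n
      rw [rowS_zero, hY0, ← hE] at this; linarith
    · have := hdo n
      rw [rowS_one k hk g, hY1, ← hE, ← hO] at this; linarith
  refine ⟨Y, hsol, ?_⟩
  by_contra hcon
  push Not at hcon
  have hgz : ∀ s, g s = 0 := by
    intro s
    by_cases hs : s < k
    · simp [hgdef, hcon s hs]
    · exact hg s (by omega)
  have hE0 : E = 0 := by simp [hE, hgz]
  have hO0 : O = 0 := by simp [hO, hgz]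
  rw [hE0] at hα
  rw [hO0] at hβ
  rcases hao with h | h
  · exact h (by linarith)
  · exact h (by linarith)

/-! ### Eigenvalues of the graph -/

section graph

variable {W : Type*} [Fintype W] [DecidableEq W]

lemma adj_mulVec (G : SimpleGraph W) (τ : W → ℕ)
    (hadj : ∀ u v, G.Adj u v ↔ u ≠ v ∧ stair (τ u) (τ v)) (x : W → ℝ) (u : W) :
    (adjMat G *ᵥ x) u = (∑ v, if stair (τ u) (τ v) then x v else 0) - x u := by
  have hx : x u = ∑ v, if v = u then x v else 0 := by simp
  rw [hx, ← Finset.sum_sub_distrib]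
  simp only [Matrix.mulVec, dotProduct, adjMat, SimpleGraph.adjMatrix_apply]
  apply Finset.sum_congr rfl
  intro v _
  by_cases h : v = u
  · subst h
    simp [stair]
  · have h' : u ≠ v := fun e => h e.symm
    simp [hadj, h, h']

variable (G : SimpleGraph W) (τ : W → ℕ) (c : ℕ → ℕ) (k : ℕ)

lemma no_kernel (hk : 0 < k) (hc : ∀ t, k ≤ t → c t = 0)
    (hadj : ∀ u v, G.Adj u v ↔ u ≠ v ∧ stair (τ u) (τ v))
    (hsum : ∀ h : ℕ → ℝ, ∑ u, h (τ u) = ∑ t ∈ Finset.range k, c t * h t)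
    (l : List ℕ) (hlen : l.length = k) (hl : ∀ i (h : i < l.length), c i = l[i])
    (hf : fr 1 l ≠ 0) (x : W → ℝ) (hx : adjMat G *ᵥ x = 0) : x = 0 := by
  set Y : ℕ → ℝ := fun t => ∑ v, if stair t (τ v) then x v else 0 with hYdef
  have hxY : ∀ u, x u = Y (τ u) := by
    intro u
    have := congrFun hx u
    rw [adj_mulVec G τ hadj] at this
    simp only [Pi.zero_apply] at this
    simp only [hYdef]; linarith
  have hY : ∀ t, Y t = 1 * rowS k (fun s => c s * Y s) t := by
    intro t
    have h1 : Y t = ∑ v, (fun s => if stair t s then Y s else 0) (τ v) := by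
      simp only [← hxY]; rfl
    rw [h1, hsum (fun s => if stair t s then Y s else 0), one_mul]
    unfold rowS
    apply Finset.sum_congr rfl
    intro s _
    simp
  obtain ⟨o, hcl, hst⟩ := sol_closing 1 c k hk hc Y hY
  rw [← hlen] at hcl
  obtain ⟨ha, ho⟩ := closing_unique 1 c l hl hf _ _ hcl
  funext u
  rw [hxY u, ← hst, ha, ho, (st_lin 1 c 0 0 _).2]
  simp

lemma has_eig (hk : 0 < k) (hc : ∀ t, k ≤ t → c t = 0)
    (hadj : ∀ u v, G.Adj u v ↔ u ≠ v ∧ stair (τ u) (τ v))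
    (hsum : ∀ h : ℕ → ℝ, ∑ u, h (τ u) = ∑ t ∈ Finset.range k, c t * h t)
    (hsurj : ∀ t < k, ∃ u, τ u = t)
    (l : List ℕ) (hlen : l.length = k) (hl : ∀ i (h : i < l.length), c i = l[i])
    (r : ℝ) (hr : 0 < r) (hf : fr r l = 0) :
    ∃ x : W → ℝ, x ≠ 0 ∧ adjMat G *ᵥ x = (1 / r - 1) • x := by
  obtain ⟨a, o, hao, hcl⟩ := closing_exists r c l hl hf
  rw [hlen] at hcl
  obtain ⟨Y, hY, t, htk, ht⟩ := closing_sol r c k hk hc a o hcl hao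
  refine ⟨fun u => Y (τ u), ?_, ?_⟩
  · intro h
    obtain ⟨u, hu⟩ := hsurj t htk
    apply ht
    rw [← hu]; exact congrFun h u
  · funext u
    rw [adj_mulVec G τ hadj]
    have h1 := hsum (fun s => if stair (τ u) s then Y s else 0)
    rw [h1]
    have h2 : ∑ s ∈ Finset.range k, (c s : ℝ) * (if stair (τ u) s then Y s else 0)
        = rowS k (fun s => c s * Y s) (τ u) := by
      unfold rowS
      apply Finset.sum_congr rfl
      intro s _
      simp
    rw [h2]
    have h3 := hY (τ u)
    simp only [Pi.smul_apply, smul_eq_mul]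
    have : rowS k (fun s => c s * Y s) (τ u) = 1 / r * Y (τ u) := by
      field_simp; linarith
    rw [this]; ring

lemma eig_mem (x : W → ℝ) (μ : ℝ) (hx : x ≠ 0) (h : adjMat G *ᵥ x = μ • x) :
    ∃ i, eigs G i = μ := by
  have h1 : Module.End.HasEigenvalue (Matrix.toLin' (adjMat G)) μ :=
    Module.End.hasEigenvalue_of_hasEigenvector
      (x := x) ⟨Module.End.mem_eigenspace_iff.mpr (by simpa using h), hx⟩
  have h2 := h1.mem_spectrum
  rw [Matrix.spectrum_toLin', (adjMat_isHermitian G).spectrum_real_eq_range_eigenvalues] at h2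
  exact h2

lemma eig_vec (i : W) : ∃ x : W → ℝ, x ≠ 0 ∧ adjMat G *ᵥ x = eigs G i • x := by
  refine ⟨(adjMat_isHermitian G).eigenvectorBasis i, ?_, ?_⟩
  · intro h
    have := (adjMat_isHermitian G).eigenvectorBasis.orthonormal.ne_zero i
    apply this
    ext j
    exact congrFun h j
  · exact (adjMat_isHermitian G).mulVec_eigenvectorBasis i

end graph

/-- List part: consequences of the third entry being zero. -/
lemma third_zero (s : Multiset ℝ) (hcard : 3 ≤ s.card)
    (h : ((s.sort (· ≤ ·)).reverse).getD 2 0 = 0) :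
    (0 : ℝ) ∈ s ∧ ∀ a b c : ℝ, a ∈ s → b ∈ s → c ∈ s → 0 < a → a < b → b < c → False := by
  set L := (s.sort (· ≤ ·)).reverse with hL
  have hlen : L.length = s.card := by simp [hL]
  have hmem : ∀ a, a ∈ L ↔ a ∈ s := by intro a; simp [hL]
  have hpw : L.Pairwise (fun a b => b ≤ a) := by
    rw [hL, List.pairwise_reverse]
    exact Multiset.pairwise_sort s (· ≤ ·)
  have h2 : 2 < L.length := by omega
  rw [List.getD_eq_getElem _ _ h2] at h
  refine ⟨(hmem 0).mp (h ▸ List.getElem_mem h2), ?_⟩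
  intro a b c ha hb hc h0 hab hbc
  have key : ∀ y, y ∈ s → 0 < y → ∃ i, i < 2 ∧ ∃ h : i < L.length, L[i] = y := by
    intro y hy hy0
    obtain ⟨i, hi, hiy⟩ := List.getElem_of_mem ((hmem y).mpr hy)
    refine ⟨i, ?_, hi, hiy⟩
    by_contra hcon
    rcases Nat.lt_or_ge 2 i with h3 | h3
    · have := List.pairwise_iff_getElem.mp hpw 2 i h2 hi h3
      linarith
    · have : i = 2 := by omega
      subst this
      linarith
  obtain ⟨i, hi, hi', hia⟩ := key a ha h0
  obtain ⟨j, hj, hj', hjb⟩ := key b hb (by linarith)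
  obtain ⟨m, hm, hm', hmc⟩ := key c hc (by linarith)
  have hij : i ≠ j := by rintro rfl; linarith
  have him : i ≠ m := by rintro rfl; linarith
  have hjm : j ≠ m := by rintro rfl; linarith
  omega

lemma main_abstract {W : Type*} [Finite W] (G : SimpleGraph W) (τ : W → ℕ) (c : ℕ → ℕ) (k : ℕ)
    (h4 : 4 ≤ k) (h14 : k ≤ 14) (hc : ∀ t, k ≤ t → c t = 0) (hc1 : ∀ t < k, 1 ≤ c t)
    (hcs : ∑ t ∈ Finset.range k, c t = 15)
    (hadj : ∀ u v, G.Adj u v ↔ u ≠ v ∧ stair (τ u) (τ v))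
    (hsum : ∀ (_ : Fintype W) (h : ℕ → ℝ), ∑ u, h (τ u) = ∑ t ∈ Finset.range k, c t * h t)
    (hsurj : ∀ t < k, ∃ u, τ u = t) : lam G 3 ≠ 0 := by
  intro h
  unfold lam at h
  letI := Fintype.ofFinite W
  letI := Classical.decEq W
  have hcard : 3 ≤ (Finset.univ.val.map (eigs G)).card := by
    have h1 := hsum inferInstance (fun _ => 1)
    simp only [mul_one, Finset.sum_const, nsmul_eq_mul] at h1
    have h2 : Fintype.card W = 15 := by
      rw [← hcs, ← Finset.card_univ]; exact_mod_cast h1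
    rw [Multiset.card_map, Finset.card_val, Finset.card_univ, h2]; norm_num
  obtain ⟨hz, hno⟩ := third_zero _ hcard h
  set l := List.ofFn (fun t : Fin k => c t) with hl
  have hlen : l.length = k := by simp [hl]
  have hlc : ∀ i (h : i < l.length), c i = l[i] := by intro i h; simp [hl]
  have hgood : good l = true := by
    apply good_of l (by omega) (by omega)
    · intro x hx
      rw [hl, List.mem_ofFn] at hx
      obtain ⟨t, rfl⟩ := hx
      exact hc1 t t.2
    · rw [hl, List.sum_ofFn, ← hcs, Finset.sum_range]
  rcases good_cases l hgood with hf | ⟨r₁, r₂, r₃, h0, h12, h23, h31, f1, f2, f3⟩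
  · rw [Multiset.mem_map] at hz
    obtain ⟨i, _, hi⟩ := hz
    obtain ⟨x, hx, hAx⟩ := eig_vec G i
    rw [hi, zero_smul] at hAx
    exact hx (no_kernel G τ c k (by omega) hc hadj (hsum _) l hlen hlc hf x hAx)
  · have key : ∀ r, 0 < r → fr r l = 0 → (1 / r - 1) ∈ Finset.univ.val.map (eigs G) := by
      intro r hr hf
      obtain ⟨x, hx, hAx⟩ := has_eig G τ c k (by omega) hc hadj (hsum _) hsurj l hlen hlc r hr hf
      obtain ⟨i, hi⟩ := eig_mem G x _ hx hAx
      rw [Multiset.mem_map]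
      exact ⟨i, Finset.mem_univ_val i, hi⟩
    have p2 : 0 < r₂ := by linarith
    have p3 : 0 < r₃ := by linarith
    refine hno _ _ _ (key r₃ p3 f3) (key r₂ p2 f2) (key r₁ h0 f1) ?_ ?_ ?_
    · have := one_lt_one_div p3 h31; linarith
    · have := one_div_lt_one_div_of_lt p2 h23; linarith
    · have := one_div_lt_one_div_of_lt h0 h12; linarith

/-! ### The graphs `B_k` -/

/-- Path-order position of a block. -/
def pos {k : ℕ} : Fin ((k + 1) / 2) ⊕ Fin (k / 2) → Fin k
  | Sum.inl i => ⟨2 * (i : ℕ), by have := i.isLt; omega⟩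
  | Sum.inr j => ⟨2 * (k / 2 - 1 - (j : ℕ)) + 1, by have := j.isLt; omega⟩

lemma pos_bij (k : ℕ) : Function.Bijective (pos (k := k)) := by
  rw [Fintype.bijective_iff_injective_and_card]
  constructor
  · rintro (i | i) (j | j) h <;> simp only [pos, Fin.mk.injEq] at h
    · congr 1; ext; omega
    · omega
    · omega
    · have := i.isLt; have := j.isLt; congr 1; ext; omega
  · simp; omega

lemma toIdx_bij (k : ℕ) : Function.Bijective (toIdx (k := k)) := by
  rw [Fintype.bijective_iff_injective_and_card]
  constructor
  · rintro (i | i) (j | j) h <;> simp only [toIdx, Fin.mk.injEq] at h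
    · congr 1; ext; omega
    · have := i.isLt; omega
    · have := j.isLt; omega
    · congr 1; ext; omega
  · simp; omega

lemma oboudi_stair {k : ℕ} (a b : Fin ((k + 1) / 2) ⊕ Fin (k / 2)) :
    (a = b ∨ (oboudi k).Adj a b) ↔ stair (pos a : ℕ) (pos b : ℕ) := by
  rcases a with i | i <;> rcases b with j | j
  · have : stair (2 * (i : ℕ)) (2 * (j : ℕ)) := by unfold stair; omega
    simp [oboudi, pos, this, em]
  · have hi := i.isLt
    have hj := j.isLt
    simp only [oboudi, pos, SimpleGraph.fromRel_adj, stair]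
    simp
    omega
  · have hi := i.isLt
    have hj := j.isLt
    simp only [oboudi, pos, SimpleGraph.fromRel_adj, stair]
    simp
    omega
  · have : stair (2 * (k / 2 - 1 - (i : ℕ)) + 1) (2 * (k / 2 - 1 - (j : ℕ)) + 1) := by
      unfold stair; omega
    simp [oboudi, pos, this, em]

theorem no_lambda3_zero_order15 (k : ℕ) (hk4 : 4 ≤ k) (hk14 : k ≤ 14)
    (nn : Fin k → ℕ) (hnn : ∀ i, 1 ≤ nn i) (hsum : (∑ i, nn i) = 15) :
    lam (bGraph k nn) 3 ≠ 0 := by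
  set e := Equiv.ofBijective _ (pos_bij k) with he
  have hee : ∀ v, e v = pos v := fun v => rfl
  set c : ℕ → ℕ := fun t => if h : t < k then nn (toIdx (e.symm ⟨t, h⟩)) else 0 with hcdef
  have hcv : ∀ v, c (pos v : ℕ) = nn (toIdx v) := by
    intro v
    have h1 : e.symm (pos v) = v := by rw [← hee, Equiv.symm_apply_apply]
    simp only [hcdef, Fin.is_lt, dite_true, Fin.eta, h1]
  refine main_abstract (bGraph k nn) (fun u => (pos u.1 : ℕ)) c k hk4 hk14 ?_ ?_ ?_ ?_ ?_ ?_
  · intro t ht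
    simp only [hcdef]
    rw [dif_neg (by omega)]
  · intro t ht
    simp only [hcdef]
    rw [dif_pos ht]
    exact hnn _
  · rw [Finset.sum_range, ← (pos_bij k).sum_comp (fun t : Fin k => c t)]
    simp only [hcv]
    rw [(toIdx_bij k).sum_comp nn, hsum]
  · intro u v
    rw [← oboudi_stair]
    simp only [bGraph, lexProd, SimpleGraph.fromRel_adj]
    constructor
    · rintro ⟨h1, h2 | h2⟩
      · exact ⟨h1, h2⟩
      · refine ⟨h1, ?_⟩
        rcases h2 with h2 | h2
        · exact Or.inl h2.symm
        · exact Or.inr h2.symm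
    · rintro ⟨h1, h2⟩
      exact ⟨h1, Or.inl h2⟩
  · intro inst h
    have hi : inst = Sigma.instFintype := Subsingleton.elim _ _
    subst hi
    rw [Fintype.sum_sigma, Finset.sum_range,
      ← (pos_bij k).sum_comp (fun t : Fin k => (c t : ℝ) * h t)]
    apply Finset.sum_congr rfl
    intro v _
    rw [hcv]
    simp
  · intro t ht
    refine ⟨⟨e.symm ⟨t, ht⟩, ⟨0, hnn _⟩⟩, ?_⟩
    show ((pos (e.symm ⟨t, ht⟩) : Fin k) : ℕ) = t
    rw [← hee, Equiv.apply_symm_apply]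

end TwoPosEig
end
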